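/- arXiv:1404.3343 — 3 statements merged into one kernel-verified Lean document; each statement's English description precedes it below -/
import Mathlib

section
/- Let S be a non-abelian finite simple group and p a prime. Let G be the product over (representatives of isomorphism classes of) all perfect group extensions of S by C_p^k, for all k ∈ ℕ. Then G satisfies: every open subgroup of G has only finitely many closed normal subgroups with cyclic quotient of any fixed order n; but G does not satisfy the uniform version: for m = |S|, the quantities I_G(p,m) = sup{ I_H(p) : H ≤ G open, (G:H) ≤ m } are infinite. -/
/-- The set of closed normal subgroups `N` of `G` with `G/N` cyclic of order `n`,
encoded as kernels of surjective homomorphisms onto the cyclic group of order `n`. -/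
def cyclicKernels (G : Type*) [Group G] [TopologicalSpace G] (n : ℕ) : Set (Subgroup G) :=
  {N | IsClosed (N : Set G) ∧
    ∃ f : G →* Multiplicative (ZMod n), Function.Surjective f ∧ f.ker = N}

/-- `Q` is a perfect extension of `S` by an elementary abelian `p`-group `C_p^k` for some `k`. -/
def IsPerfectExtensionBy (S : Type*) [Group S] (p : ℕ) (Q : Type*) [Group Q] : Prop :=
  commutator Q = ⊤ ∧ ∃ f : Q →* S, Function.Surjective f ∧
    ∃ k : ℕ, Nonempty (↥f.ker ≃* (Fin k → Multiplicative (ZMod p)))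

set_option linter.style.haveILetI false

open scoped commutatorElement

lemma aux_elem (p : ℕ) (hp : p.Prime) (K : Type) [Group K] [Finite K]
    (hc : ∀ a b : K, a * b = b * a) (h : ∀ a : K, a ^ p = 1) :
    ∃ k : ℕ, Nonempty (K ≃* (Fin k → Multiplicative (ZMod p))) := by
  haveI : Fact p.Prime := ⟨hp⟩
  letI : CommGroup K := { ‹Group K› with mul_comm := hc }
  letI : Module (ZMod p) (Additive K) := AddCommGroup.zmodModule (n := p) (fun x => h x.toMul)
  haveI : Finite (Additive K) := ‹Finite K›
  haveI : Module.Finite (ZMod p) (Additive K) := Module.Finite.of_finite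
  let e := (Module.finBasis (ZMod p) (Additive K)).equivFun
  refine ⟨_, ⟨MulEquiv.mk' ⟨fun x i => Multiplicative.ofAdd (e (Additive.ofMul x) i),
    fun y => (e.symm (fun i => (y i).toAdd)).toMul, ?_, ?_⟩ ?_⟩⟩
  · intro x; simp
  · intro y; simp
  · intro x y
    funext i
    simp

lemma aux_perfect {S Γ : Type*} [Group S] [Group Γ] (hS : commutator S = ⊤) (T : S →* Γ) :
    commutator (Subgroup.normalClosure (T.range : Set Γ)) = ⊤ := by
  set N := Subgroup.normalClosure (T.range : Set Γ) with hN
  have h1 : N ≤ ⁅N, N⁆ := by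
    rw [hN]
    apply Subgroup.normalClosure_le_normal
    have h2 : T.range ≤ N := Subgroup.subset_normalClosure
    have h3 : T.range = ⁅T.range, T.range⁆ := by
      rw [MonoidHom.range_eq_map, ← Subgroup.map_commutator, ← commutator_def, hS]
    show T.range ≤ ⁅N, N⁆
    rw [h3]
    exact Subgroup.commutator_mono h2 h2
  rw [eq_top_iff]
  intro x _
  have h4 : (x : Γ) ∈ (commutator N).map N.subtype := by
    rw [Subgroup.map_subtype_commutator]
    exact h1 x.2
  obtain ⟨y, hy, hxy⟩ := h4
  have : y = x := Subtype.ext hxy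
  exact this ▸ hy

lemma aux_simple (S : Type*) [Group S] [IsSimpleGroup S]
    (hnonab : ∃ a b : S, a * b ≠ b * a) : commutator S = ⊤ := by
  rcases (inferInstance : (commutator S).Normal).eq_bot_or_eq_top with h | h
  · exfalso
    obtain ⟨a, b, hab⟩ := hnonab
    apply hab
    have : ⁅a, b⁆ ∈ commutator S :=
      Subgroup.commutator_mem_commutator (Subgroup.mem_top a) (Subgroup.mem_top b)
    rw [h, Subgroup.mem_bot] at this
    exact commutatorElement_eq_one_iff_mul_comm.1 this
  · exact h

lemma aux_exists (S : Type) [Group S] [Finite S] [Nontrivial S] (hS : commutator S = ⊤)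
    (p : ℕ) (hp : p.Prime) (r : ℕ) :
    ∃ (Q : Type) (_ : Group Q) (_ : Finite Q), commutator Q = ⊤ ∧
      ∃ f : Q →* S, Function.Surjective f ∧ ∃ k : ℕ, r ≤ k ∧
        Nonempty (↥f.ker ≃* (Fin k → Multiplicative (ZMod p))) := by
  classical
  haveI : Fact p.Prime := ⟨hp⟩
  let D := Fin r → Multiplicative (ZMod p)
  haveI : Finite (Multiplicative (ZMod p)) := inferInstanceAs (Finite (ZMod p))
  haveI : Finite D := inferInstance
  let Γ := RegularWreathProduct D S
  let T : S →* Γ := RegularWreathProduct.inl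
  let N := Subgroup.normalClosure (T.range : Set Γ)
  let f : N →* S := (RegularWreathProduct.rightHom : Γ →* S).comp N.subtype
  have hTN : ∀ s, T s ∈ N := fun s => Subgroup.subset_normalClosure ⟨s, rfl⟩
  refine ⟨N, inferInstance, inferInstance, aux_perfect hS T, f, ?_, ?_⟩
  · intro s
    exact ⟨⟨T s, hTN s⟩, rfl⟩
  have hD : ∀ d : D, d ^ p = 1 := by
    intro d
    funext i
    show Multiplicative.ofAdd (p • (d i).toAdd) = 1
    simp
  have hker : ∀ x : f.ker, (x : Γ).right = 1 := fun x => x.2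
  let L : f.ker →* (S → D) :=
    { toFun := fun x => (x : Γ).left
      map_one' := rfl
      map_mul' := fun x y => by
        show ((x : Γ) * (y : Γ)).left = _
        rw [RegularWreathProduct.mul_left, hker x]
        simp }
  have hL : Function.Injective L := by
    intro x y hxy
    apply Subtype.ext
    apply Subtype.ext
    exact RegularWreathProduct.ext hxy ((hker x).trans (hker y).symm)
  obtain ⟨k, ⟨e⟩⟩ := aux_elem p hp f.ker
    (fun a b => hL (by rw [map_mul, map_mul, mul_comm]))
    (fun a => hL (by rw [map_pow, map_one]; funext s; exact hD _))
  refine ⟨k, ?_, ⟨e⟩⟩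
  obtain ⟨s, hs⟩ := exists_ne (1 : S)
  let A : D → Γ := fun d => ⟨Pi.mulSingle 1 d, 1⟩
  have hmem : ∀ d, A d * T s * (A d)⁻¹ * (T s)⁻¹ ∈ N := fun d =>
    N.mul_mem (Subgroup.normalClosure_normal.conj_mem _ (hTN s) _) (N.inv_mem (hTN s))
  let φ : D → f.ker := fun d => ⟨⟨_, hmem d⟩, by
    show (1 * s * 1⁻¹ * s⁻¹ : S) = 1
    simp⟩
  have hφ : ∀ d, L (φ d) 1 = d := by
    intro d
    have h : ∀ (a : S → D), ((⟨a, 1⟩ : RegularWreathProduct D S) * RegularWreathProduct.inl s *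
        (⟨a, 1⟩ : RegularWreathProduct D S)⁻¹ * (RegularWreathProduct.inl s)⁻¹).left 1
        = a 1 * (a s⁻¹)⁻¹ := by
      intro a
      simp
    refine (h (Pi.mulSingle 1 d)).trans ?_
    rw [Pi.mulSingle_eq_same, Pi.mulSingle_eq_of_ne (inv_ne_one.2 hs)]
    simp
  have hinj : Function.Injective (fun d => e (φ d)) := by
    intro a b hab
    have := e.injective hab
    rw [← hφ a, ← hφ b, this]
  have hcard := Nat.card_le_card_of_injective _ hinj
  have hz : Nat.card (Multiplicative (ZMod p)) = p := Nat.card_zmod p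
  simp only [D, Nat.card_fun, Nat.card_fin, hz] at hcard
  have := (Nat.pow_le_pow_iff_right hp.one_lt).1 (by simpa [hz] using hcard)
  exact this

lemma aux_open {ι : Type} {P : ι → Type} [∀ i, Group (P i)]
    [∀ i, TopologicalSpace (P i)] 
    (M : Subgroup (∀ i, P i)) (hM : IsOpen (M : Set (∀ i, P i))) :
    ∃ F : Finset ι, ∀ x : ∀ i, P i, (∀ i ∈ F, x i = 1) → x ∈ M := by
  obtain ⟨F, u, h1, h2⟩ := isOpen_pi_iff.1 hM 1 M.one_mem
  refine ⟨F, fun x hx => h2 ?_⟩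
  intro i hi
  rw [hx i hi]
  exact (h1 i hi).2

lemma aux_gen {ι : Type} {P : ι → Type} [∀ i, Group (P i)] [DecidableEq ι]
    (M : Subgroup (∀ i, P i)) (F F' : Finset ι)
    (hM : ∀ x : ∀ i, P i, (∀ i ∈ F', x i = 1) → x ∈ M)
    (hs : ∀ i, i ∉ F → ∀ a : P i, Pi.mulSingle i a ∈ M) (T : Finset ι) :
    ∀ x : ∀ i, P i, (∀ i ∈ F, x i = 1) → (∀ i ∈ F', i ∉ T → x i = 1) → x ∈ M := by
  induction T using Finset.induction_on with
  | empty => exact fun x _ h => hM x (fun i hi => h i hi (by simp))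
  | insert j T hj ih =>
    intro x hx hx'
    have e : x = Function.update x j 1 * Pi.mulSingle j (x j) := by
      funext i
      by_cases h : i = j
      · subst h; simp
      · simp [h]
    rw [e]
    refine M.mul_mem (ih _ ?_ ?_) ?_
    · intro i hi
      by_cases h : i = j
      · subst h; simp
      · simp [h, hx i hi]
    · intro i hi hiT
      by_cases h : i = j
      · subst h; simp
      · simp only [Function.update_of_ne h]
        exact hx' i hi (by simp [h, hiT])
    · by_cases h : j ∈ F
      · rw [hx j h, Pi.mulSingle_one]; exact M.one_mem
      · exact hs j h _

lemma aux_part1 {ι : Type} {P : ι → Type} [∀ i, Group (P i)] [∀ i, Finite (P i)]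
    [∀ i, TopologicalSpace (P i)] [∀ i, DiscreteTopology (P i)]
    (hP : ∀ i, commutator (P i) = ⊤)
    (H : Subgroup (∀ i, P i)) (hH : IsOpen (H : Set (∀ i, P i))) (n : ℕ) (hn : 0 < n) :
    (cyclicKernels H n).Finite := by
  classical
  haveI : NeZero n := ⟨hn.ne'⟩
  haveI : Finite (Multiplicative (ZMod n)) := inferInstanceAs (Finite (ZMod n))
  obtain ⟨F, hF⟩ := aux_open H hH
  have key : ∀ N ∈ cyclicKernels H n, ∀ x : H, (∀ i ∈ F, x.1 i = 1) → x ∈ N := by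
    rintro N ⟨hcl, f, -, rfl⟩ x hx
    have ho : IsOpen (f.ker : Set H) := Subgroup.isOpen_of_isClosed_of_finiteIndex _ hcl
    have hMo : IsOpen ((f.ker.map H.subtype : Subgroup (∀ i, P i)) : Set (∀ i, P i)) := by
      rw [Subgroup.coe_map]
      exact hH.isOpenMap_subtype_val _ ho
    obtain ⟨F', hF'⟩ := aux_open _ hMo
    have hs : ∀ i, i ∉ F → ∀ a : P i, Pi.mulSingle i a ∈ f.ker.map H.subtype := by
      intro i hi a
      have hm : ∀ a : P i, Pi.mulSingle i a ∈ H := by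
        intro a
        apply hF
        intro j hj
        have : j ≠ i := fun h => hi (h ▸ hj)
        simp [this]
      let g : P i →* H := (MonoidHom.mulSingle P i).codRestrict H hm
      have hg : commutator (P i) ≤ (f.comp g).ker := Abelianization.commutator_subset_ker _
      rw [hP i] at hg
      exact ⟨g a, hg (Subgroup.mem_top a), rfl⟩
    obtain ⟨y, hy, hyx⟩ := aux_gen _ F F' hF' hs F' x.1 hx (fun i h h' => absurd h h')
    have : y = x := Subtype.ext hyx
    exact this ▸ hy
  let R : Subgroup H → Set (∀ i : F, P i) := fun N => {y | ∃ x ∈ N, ∀ i : F, x.1 i = y i}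
  apply Set.Finite.of_finite_image (f := R) (Set.toFinite _)
  have hle : ∀ N ∈ cyclicKernels H n, ∀ N' ∈ cyclicKernels H n, R N = R N' → N ≤ N' := by
    intro N _ N' hN' h x hx
    have : (fun i : F => x.1 i) ∈ R N' := h ▸ ⟨x, hx, fun _ => rfl⟩
    obtain ⟨x', hx', he⟩ := this
    have h2 : x'⁻¹ * x ∈ N' := by
      apply key N' hN'
      intro i hi
      have := he ⟨i, hi⟩
      simp only at this
      simp [this]
    have := N'.mul_mem hx' h2
    rwa [mul_inv_cancel_left] at this
  intro N hN N' hN' h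
  exact le_antisymm (hle N hN N' hN' h) (hle N' hN' N hN h.symm)

lemma aux_part2 {G Q S : Type*} [Group G] [TopologicalSpace G] [Group Q] [TopologicalSpace Q]
    [DiscreteTopology Q] [Group S] [Finite S] (p : ℕ) (hp : p.Prime) (π : G →* Q)
    (hπ : Continuous π) (hsurj : Function.Surjective π) (f : Q →* S)
    (hf : Function.Surjective f) (k : ℕ) (e : f.ker ≃* (Fin k → Multiplicative (ZMod p))) :
    ∃ H : Subgroup G, IsOpen (H : Set G) ∧ H.index ≤ Nat.card S ∧
      ((cyclicKernels H p).Finite → k ≤ Nat.card (cyclicKernels H p)) := by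
  haveI : Fact p.Prime := ⟨hp⟩
  refine ⟨(f.comp π).ker, ?_, ?_, ?_⟩
  · have : ((f.comp π).ker : Set G) = π ⁻¹' (f.ker : Set Q) := rfl
    rw [this]
    exact (isOpen_discrete _).preimage hπ
  · rw [Subgroup.index_ker]
    exact Nat.card_le_card_of_injective _ Subtype.val_injective
  · intro hfin
    haveI := hfin.to_subtype
    let ρ : (f.comp π).ker →* f.ker :=
      (π.comp (f.comp π).ker.subtype).codRestrict f.ker (fun x => x.2)
    have hρ : Function.Surjective ρ := by
      rintro ⟨q, hq⟩
      obtain ⟨g, rfl⟩ := hsurj q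
      exact ⟨⟨g, hq⟩, rfl⟩
    have hρc : Continuous ρ := (hπ.comp continuous_subtype_val).subtype_mk _
    let c : Fin k → (f.comp π).ker →* Multiplicative (ZMod p) := fun j =>
      ((Pi.evalMonoidHom (fun _ : Fin k => Multiplicative (ZMod p)) j).comp e.toMonoidHom).comp ρ
    have hc : ∀ y : Fin k → Multiplicative (ZMod p), ∃ x, ∀ j, c j x = y j := by
      intro y
      obtain ⟨x, hx⟩ := hρ (e.symm y)
      refine ⟨x, fun j => ?_⟩
      show e (ρ x) j = y j
      rw [hx, e.apply_symm_apply]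
    have hmem : ∀ j, (c j).ker ∈ cyclicKernels (f.comp π).ker p := by
      intro j
      refine ⟨?_, c j, ?_, rfl⟩
      · have : ((c j).ker : Set (f.comp π).ker) = ρ ⁻¹' {z | e z j = 1} := rfl
        rw [this]
        exact (isClosed_discrete _).preimage hρc
      · intro a
        obtain ⟨x, hx⟩ := hc (fun _ => a)
        exact ⟨x, hx j⟩
    have hinj : Function.Injective
        (fun j => (⟨(c j).ker, hmem j⟩ : cyclicKernels (f.comp π).ker p)) := by
      intro i j hij
      by_contra hne
      have hk : (c i).ker = (c j).ker := congrArg Subtype.val hij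
      obtain ⟨x, hx⟩ := hc (Pi.mulSingle i (Multiplicative.ofAdd 1))
      have hj : x ∈ (c j).ker := by
        rw [MonoidHom.mem_ker, hx]
        simp [Ne.symm hne]
      rw [← hk, MonoidHom.mem_ker, hx, Pi.mulSingle_eq_same] at hj
      exact one_ne_zero (α := ZMod p) (Multiplicative.ofAdd.injective hj)
    simpa using Nat.card_le_card_of_injective _ hinj

/-- Let `S` be a non-abelian finite simple group, `p` a prime, and `G = ∏ᵢ P i` a product of
finite groups realizing (up to isomorphism) exactly the perfect extensions of `S` by the groups
`C_p^k`, `k ∈ ℕ`.  Then every open subgroup of `G` has only finitely many closed normal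
subgroups with cyclic quotient of any fixed order `n` (condition (G2)), but the uniform bound
fails: for `m = |S|`, the quantity `I_G(p,m)` is infinite. -/
theorem stmt10 (S : Type*) [Group S] [Finite S] [IsSimpleGroup S]
    (hnonab : ∃ a b : S, a * b ≠ b * a) (p : ℕ) (hp : p.Prime)
    (ι : Type) (P : ι → Type) [∀ i, Group (P i)] [∀ i, Finite (P i)]
    [∀ i, TopologicalSpace (P i)] [∀ i, DiscreteTopology (P i)]
    (hP : ∀ i, IsPerfectExtensionBy S p (P i))
    (hall : ∀ (Q : Type) [Group Q] [Finite Q],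
      IsPerfectExtensionBy S p Q → ∃ i, Nonempty (Q ≃* P i)) :
    (∀ H : Subgroup (∀ i, P i), IsOpen (H : Set (∀ i, P i)) → ∀ n : ℕ, 0 < n →
        (cyclicKernels H n).Finite) ∧
      ¬ ∃ k : ℕ, ∀ H : Subgroup (∀ i, P i), IsOpen (H : Set (∀ i, P i)) →
          H.index ≤ Nat.card S →
            (cyclicKernels H p).Finite ∧ Nat.card (cyclicKernels H p) ≤ k := by
  refine ⟨fun H hH n hn => aux_part1 (fun i => (hP i).1) H hH n hn, ?_⟩
  rintro ⟨K, hK⟩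
  have hS := aux_simple S hnonab
  let σ : Shrink.{0} S ≃* S := Shrink.mulEquiv
  haveI : Nontrivial (Shrink.{0} S) := σ.toEquiv.nontrivial
  haveI : Finite (Shrink.{0} S) := Finite.of_equiv _ σ.symm.toEquiv
  have hS' : commutator (Shrink.{0} S) = ⊤ := by
    have h := Subgroup.map_commutator (⊤ : Subgroup S) ⊤ σ.symm.toMonoidHom
    have h2 : (⊤ : Subgroup S).map σ.symm.toMonoidHom = ⊤ :=
      Subgroup.map_top_of_surjective _ σ.symm.surjective
    rw [← commutator_def, hS, h2] at h
    rw [commutator_def]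
    exact h.symm
  obtain ⟨Q, _, _, hQ, f, hf, k, hk, ⟨e⟩⟩ := aux_exists (Shrink.{0} S) hS' p hp (K + 1)
  let g : Q →* S := σ.toMonoidHom.comp f
  have hg : Function.Surjective g := σ.surjective.comp hf
  have hker : g.ker = f.ker := by
    ext x
    simp [g, MonoidHom.mem_ker]
  obtain ⟨i, ⟨w⟩⟩ := hall Q ⟨hQ, g, hg, k, ⟨(MulEquiv.subgroupCongr hker).trans e⟩⟩
  letI : TopologicalSpace Q := ⊥
  haveI : DiscreteTopology Q := ⟨rfl⟩
  obtain ⟨H, h1, h2, h3⟩ := aux_part2 p hp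
    (w.symm.toMonoidHom.comp (Pi.evalMonoidHom P i))
    ((continuous_of_discreteTopology (f := w.symm)).comp (continuous_apply i))
    (w.symm.surjective.comp (Function.surjective_eval i)) g hg k
    ((MulEquiv.subgroupCongr hker).trans e)
  obtain ⟨h4, h5⟩ := hK H h1 h2
  have := h3 h4
  omega
end

section
/- Suppose the field F of characteristic zero contains all roots of unity. Then its absolute Galois group G_F satisfies the uniform condition (G2*) if and only if every field F* elementarily equivalent to F satisfies: for every n and every finite extension E/F*, the index (E^× : (E^×)^n) is finite. -/
open FirstOrder

/-- Condition (G2*): for all `n, m` there is a uniform bound `k` on the number of closed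
normal subgroups with cyclic quotient of order `n` of open subgroups of index at most `m`. -/
def CondG2Star (G : Type*) [Group G] [TopologicalSpace G] : Prop :=
  ∀ n m : ℕ, 0 < n → ∃ k : ℕ, ∀ H : Subgroup G, IsOpen (H : Set G) → H.index ≤ m →
    (cyclicKernels H n).Finite ∧ Nat.card (cyclicKernels H n) ≤ k

/-- Property (F2) for a field `K` : for every `n ≥ 1` and every finite extension `E` of `K`
(inside a fixed algebraic closure), `Eˣ/(Eˣ)ⁿ` is finite. -/
def CondF2 (K : Type*) [Field K] : Prop :=
  ∀ n : ℕ, 0 < n → ∀ E : IntermediateField K (AlgebraicClosure K), FiniteDimensional K E →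
    Finite (Eˣ ⧸ (powMonoidHom n : Eˣ →* Eˣ).range)


section GaloisSide

variable {F Ω : Type*} [Field F] [Field Ω] [Algebra F Ω] [IsGalois F Ω]

lemma kummer_gen (H : Subgroup (Ω ≃ₐ[F] Ω)) (hH : IsClosed (H : Set (Ω ≃ₐ[F] Ω)))
    (n : ℕ) (hn : 0 < n) (ζ : F) (hζ : IsPrimitiveRoot ζ n)
    (N : Subgroup H) (hN : N ∈ cyclicKernels H n) :
    ∃ α : Ω, α ≠ 0 ∧ (∀ h : H, (h : Ω ≃ₐ[F] Ω) (α ^ n) = α ^ n) ∧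
      ∀ h : H, h ∈ N ↔ (h : Ω ≃ₐ[F] Ω) α = α := by
  have : NeZero n := ⟨hn.ne'⟩
  obtain ⟨hNc, f, hf, rfl⟩ := hN
  obtain ⟨σ, hσ⟩ := hf (Multiplicative.ofAdd 1)
  have hfpow : ∀ i : ℕ, f (σ ^ i) = Multiplicative.ofAdd (i : ZMod n) := by
    intro i
    rw [map_pow, hσ, ← ofAdd_nsmul]; simp
  set N' : Subgroup (Ω ≃ₐ[F] Ω) := f.ker.map H.subtype with hN'
  have hN'c : IsClosed (N' : Set (Ω ≃ₐ[F] Ω)) := by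
    have := hH.isClosedEmbedding_subtypeVal.isClosedMap _ hNc
    exact this
  set M := IntermediateField.fixedField N' with hMdef
  have hM : M.fixingSubgroup = N' := InfiniteGalois.fixingSubgroup_fixedField ⟨N', hN'c⟩
  have hMfix : ∀ τ : H, f τ = 1 → ∀ x ∈ M, (τ : Ω ≃ₐ[F] Ω) x = x := by
    intro τ hτ x hx
    exact hx ⟨(τ : Ω ≃ₐ[F] Ω), ⟨τ, hτ, rfl⟩⟩
  let g : Fin n → (M →* Ω) := fun i =>
    ((((σ ^ (i : ℕ) : H) : Ω ≃ₐ[F] Ω) : Ω →+* Ω) : Ω →* Ω).comp (M.val : M →* Ω)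
  have hg : Function.Injective g := by
    intro i j hij
    have h1 : (((σ ^ (i : ℕ))⁻¹ * σ ^ (j : ℕ) : H) : Ω ≃ₐ[F] Ω) ∈ M.fixingSubgroup := by
      rw [IntermediateField.mem_fixingSubgroup_iff]
      intro x hx
      have := DFunLike.congr_fun hij ⟨x, hx⟩
      have h2 : ((σ ^ (i : ℕ) : H) : Ω ≃ₐ[F] Ω) x = ((σ ^ (j : ℕ) : H) : Ω ≃ₐ[F] Ω) x := this
      rw [Subgroup.coe_mul, AlgEquiv.mul_apply, ← h2, ← AlgEquiv.mul_apply, ← Subgroup.coe_mul]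
      simp
    rw [hM] at h1
    obtain ⟨τ, hτ, h3⟩ := h1
    have h4 : τ = (σ ^ (i : ℕ))⁻¹ * σ ^ (j : ℕ) := Subtype.ext h3
    have h5 : f τ = 1 := hτ
    rw [h4, map_mul, map_inv, hfpow, hfpow, inv_mul_eq_one] at h5
    have h6 : ((i : ℕ) : ZMod n) = ((j : ℕ) : ZMod n) := Multiplicative.ofAdd.injective h5
    rw [ZMod.natCast_eq_natCast_iff, Nat.ModEq, Nat.mod_eq_of_lt i.2, Nat.mod_eq_of_lt j.2] at h6
    exact Fin.ext h6
  set w : Ω := algebraMap F Ω ζ with hw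
  have hwp : IsPrimitiveRoot w n := hζ.map_of_injective (algebraMap F Ω).injective
  have hw0 : w ≠ 0 := hwp.ne_zero hn.ne'
  have hwfix : ∀ τ : Ω ≃ₐ[F] Ω, τ w = w := fun τ => τ.commutes ζ
  have hli := (linearIndependent_monoidHom M Ω).comp g hg
  rw [Fintype.linearIndependent_iff] at hli
  have hx : ∃ x : M, ∑ i : Fin n, (w⁻¹) ^ (i : ℕ) * ((σ ^ (i : ℕ) : H) : Ω ≃ₐ[F] Ω) x ≠ 0 := by
    by_contra hcon
    push Not at hcon
    have := hli (fun i => (w⁻¹) ^ (i : ℕ)) (by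
      ext x
      simpa [g] using hcon x) 0
    exact pow_ne_zero _ (inv_ne_zero hw0) this
  obtain ⟨⟨x, hxM⟩, hx⟩ := hx
  rw [Fin.sum_univ_eq_sum_range (fun i => (w⁻¹) ^ i * ((σ ^ i : H) : Ω ≃ₐ[F] Ω) x)] at hx
  set α : Ω := ∑ i ∈ Finset.range n, (w⁻¹) ^ i * ((σ ^ i : H) : Ω ≃ₐ[F] Ω) x with hα
  have hσα : (σ : Ω ≃ₐ[F] Ω) α = w * α := by
    have h1 : (σ : Ω ≃ₐ[F] Ω) α =
        w * ∑ i ∈ Finset.range n, (w⁻¹) ^ (i + 1) * ((σ ^ (i + 1) : H) : Ω ≃ₐ[F] Ω) x := by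
      rw [hα, map_sum, Finset.mul_sum]
      refine Finset.sum_congr rfl fun i _ => ?_
      rw [map_mul, map_pow, map_inv₀, hwfix, pow_succ' σ, Subgroup.coe_mul, AlgEquiv.mul_apply,
        pow_succ' w⁻¹, ← mul_assoc, ← mul_assoc, mul_inv_cancel₀ hw0, one_mul]
    rw [h1]
    congr 1
    have h2 := Finset.sum_range_succ (fun i => (w⁻¹) ^ i * ((σ ^ i : H) : Ω ≃ₐ[F] Ω) x) n
    rw [Finset.sum_range_succ'] at h2
    have h3 : ((σ ^ n : H) : Ω ≃ₐ[F] Ω) x = x := hMfix _ (by rw [hfpow]; simp) x hxM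
    rw [h3, inv_pow w n, hwp.pow_eq_one] at h2
    simp only [pow_zero, inv_one, one_mul, Subgroup.coe_one, AlgEquiv.one_apply] at h2
    exact add_right_cancel h2
  have hτα : ∀ τ : H, f τ = 1 → (τ : Ω ≃ₐ[F] Ω) α = α := by
    intro τ hτ
    rw [hα, map_sum]
    refine Finset.sum_congr rfl fun i _ => ?_
    rw [map_mul, map_pow, map_inv₀, hwfix]
    congr 1
    have h1 := hMfix ((σ ^ i)⁻¹ * τ * σ ^ i) (by simp [hτ]) x hxM
    rw [← AlgEquiv.mul_apply, ← Subgroup.coe_mul,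
      show τ * σ ^ i = σ ^ i * ((σ ^ i)⁻¹ * τ * σ ^ i) by group, Subgroup.coe_mul,
      AlgEquiv.mul_apply, h1]
  have hσj : ∀ j : ℕ, ((σ ^ j : H) : Ω ≃ₐ[F] Ω) α = w ^ j * α := by
    intro j
    induction j with
    | zero => simp
    | succ j ih =>
      rw [pow_succ', Subgroup.coe_mul, AlgEquiv.mul_apply, ih, map_mul, map_pow, hwfix, hσα]
      ring
  have hall : ∀ h : H, (h : Ω ≃ₐ[F] Ω) α = w ^ (Multiplicative.toAdd (f h)).val * α := by
    intro h
    set j := (Multiplicative.toAdd (f h)).val with hj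
    have h1 : f ((σ ^ j)⁻¹ * h) = 1 := by
      rw [map_mul, map_inv, hfpow, hj, ZMod.natCast_zmod_val]; simp
    have h2 := hτα _ h1
    rw [← hσj, ← congrArg ((σ ^ j : H) : Ω ≃ₐ[F] Ω) h2, ← AlgEquiv.mul_apply, ← Subgroup.coe_mul]
    simp
  refine ⟨α, hx, ?_, ?_⟩
  · intro h
    rw [map_pow, hall, mul_pow, ← pow_mul, mul_comm _ n, pow_mul, hwp.pow_eq_one, one_pow, one_mul]
  · intro h
    rw [hall, MonoidHom.mem_ker]
    constructor
    · intro h1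
      simp [h1]
    · intro h1
      have h2 : w ^ (Multiplicative.toAdd (f h)).val = 1 := mul_right_cancel₀ hx (by rw [h1, one_mul])
      have h3 := hwp.dvd_of_pow_eq_one _ h2
      have h4 := Nat.eq_zero_of_dvd_of_lt h3 (ZMod.val_lt _)
      rw [ZMod.val_eq_zero] at h4
      exact Multiplicative.toAdd.injective h4

end GaloisSide

/-- Among any `k+1` nonzero elements two agree modulo `n`-th powers. -/
def SmallQ (E : Type*) [Field E] (n k : ℕ) : Prop :=
  ∀ x : Fin (k + 1) → E, (∀ i, x i ≠ 0) → ∃ i j, i ≠ j ∧ ∃ y : E, x i * y ^ n = x j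

lemma finite_card_le_of_not_inj {α : Type*} (k : ℕ)
    (h : ∀ f : Fin (k + 1) → α, ¬ Function.Injective f) : Finite α ∧ Nat.card α ≤ k := by
  have hfin : Finite α := by
    by_contra hinf
    rw [not_finite_iff_infinite] at hinf
    exact h (fun i => Infinite.natEmbedding α i)
      ((Infinite.natEmbedding α).injective.comp Fin.val_injective)
  refine ⟨hfin, ?_⟩
  by_contra hlt
  push Not at hlt
  exact h (fun i => (Finite.equivFin α).symm (Fin.castLE hlt i))
    ((Finite.equivFin α).symm.injective.comp (Fin.castLE_injective hlt))

section GaloisSide2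

variable {F Ω : Type*} [Field F] [Field Ω] [Algebra F Ω] [IsGalois F Ω]

lemma cyclicKernels_bound (H : Subgroup (Ω ≃ₐ[F] Ω)) (hH : IsClosed (H : Set (Ω ≃ₐ[F] Ω)))
    (n : ℕ) (hn : 0 < n) (ζ : F) (hζ : IsPrimitiveRoot ζ n) (k : ℕ)
    (hS : SmallQ (IntermediateField.fixedField H) n k) :
    (cyclicKernels H n).Finite ∧ Nat.card (cyclicKernels H n) ≤ k := by
  refine finite_card_le_of_not_inj k fun N hN => ?_
  choose α hα0 hαn hαN using fun i => kummer_gen H hH n hn ζ hζ (N i).1 (N i).2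
  obtain ⟨i, j, hij, y, hy⟩ := hS (fun i => ⟨α i ^ n, fun h => hαn i h⟩)
    (fun i h => pow_ne_zero n (hα0 i) (congrArg Subtype.val h))
  have hy' : α i ^ n * (y : Ω) ^ n = α j ^ n := congrArg Subtype.val hy
  have hyfix : ∀ h : H, (h : Ω ≃ₐ[F] Ω) (y : Ω) = y := fun h => y.2 h
  have hwp : IsPrimitiveRoot (algebraMap F Ω ζ) n :=
    hζ.map_of_injective (algebraMap F Ω).injective
  have : NeZero n := ⟨hn.ne'⟩
  have hy0 : (y : Ω) ≠ 0 := by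
    intro h
    rw [h, zero_pow hn.ne', mul_zero] at hy'
    exact pow_ne_zero n (hα0 j) hy'.symm
  have h1 : (α j / (α i * y)) ^ n = 1 := by
    rw [div_pow, mul_pow, hy', div_self (pow_ne_zero n (hα0 j))]
  obtain ⟨l, -, hl⟩ := hwp.eq_pow_of_pow_eq_one h1
  have h2 : α j = (algebraMap F Ω (ζ ^ l) * y) * α i := by
    rw [map_pow, hl]
    field_simp [hα0 i, hy0]
  have h3 : (algebraMap F Ω (ζ ^ l) * y) ≠ 0 := by
    intro h
    rw [h, zero_mul] at h2
    exact hα0 j h2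
  apply hij
  apply hN
  ext h
  rw [hαN i, hαN j, h2, map_mul, map_mul, AlgEquiv.commutes, hyfix]
  exact ⟨fun h => by rw [h], fun h => mul_left_cancel₀ h3 h⟩

lemma exists_surj_of_cyclic {H C : Type*} [Group H] [CommGroup C] [Finite C] [IsCyclic C]
    (n : ℕ) (hC : Nat.card C ≤ n) (χ : H →* C) :
    ∃ d : Fin n, ∃ f : H →* Multiplicative (ZMod ((d : ℕ) + 1)),
      Function.Surjective f ∧ f.ker = χ.ker := by
  have h0 : 0 < Nat.card χ.range := Nat.card_pos
  have h1 : Nat.card χ.range ≤ n := (Subgroup.card_le_card_group _).trans hC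
  obtain ⟨d, hd⟩ : ∃ d, Nat.card χ.range = d + 1 := ⟨_, (Nat.succ_pred_eq_of_pos h0).symm⟩
  refine ⟨⟨d, by omega⟩, ?_⟩
  have e : χ.range ≃* Multiplicative (ZMod (d + 1)) :=
    mulEquivOfCyclicCardEq (by rw [hd]; simp [Nat.card_eq_fintype_card])
  refine ⟨e.toMonoidHom.comp χ.rangeRestrict, ?_, ?_⟩
  · exact e.surjective.comp χ.rangeRestrict_surjective
  · ext h
    simp [MonoidHom.mem_ker]

lemma smallQ_of_cyclicKernels [IsAlgClosed Ω] (E : IntermediateField F Ω)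
    (n : ℕ) (hn : 0 < n) (ζ : F) (hζ : IsPrimitiveRoot ζ n) (k : ℕ)
    (hk : ∀ d, 0 < d → d ≤ n → (cyclicKernels E.fixingSubgroup d).Finite ∧
      Nat.card (cyclicKernels E.fixingSubgroup d) ≤ k) :
    SmallQ E n (n * k * n) := by
  classical
  have : NeZero n := ⟨hn.ne'⟩
  intro x hx
  set H := E.fixingSubgroup with hH
  choose α hα using fun i => IsAlgClosed.exists_pow_nat_eq (x i : Ω) hn
  have hα0 : ∀ i, α i ≠ 0 := by
    intro i h
    have := hα i
    rw [h, zero_pow hn.ne'] at this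
    exact hx i (Subtype.ext this.symm)
  have hfixE : ∀ (h : H) (e : E), (h : Ω ≃ₐ[F] Ω) (e : Ω) = e := fun h e => h.2 e
  have hwp : IsPrimitiveRoot (algebraMap F Ω ζ) n :=
    hζ.map_of_injective (algebraMap F Ω).injective
  have hpow : ∀ i (h : H), ((h : Ω ≃ₐ[F] Ω) (α i) / α i) ^ n = 1 := by
    intro i h
    rw [div_pow, ← map_pow, hα, hfixE, div_self]
    exact fun h => hx i (Subtype.ext h)
  let χ : Fin (n * k * n + 1) → (H →* rootsOfUnity n Ω) := fun i =>
    { toFun := fun h => rootsOfUnity.mkOfPowEq ((h : Ω ≃ₐ[F] Ω) (α i) / α i) (hpow i h)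
      map_one' := by
        ext; simp [hα0 i]
      map_mul' := by
        intro g h
        ext
        obtain ⟨l, -, hl⟩ := hwp.eq_pow_of_pow_eq_one (hpow i h)
        have h2 : (h : Ω ≃ₐ[F] Ω) (α i) = algebraMap F Ω (ζ ^ l) * α i := by
          rw [map_pow, hl, div_mul_cancel₀ _ (hα0 i)]
        simp only [Subgroup.coe_mul, AlgEquiv.mul_apply, rootsOfUnity.val_mkOfPowEq_coe, Units.val_mul]
        rw [h2, map_mul, AlgEquiv.commutes]
        field_simp [hα0 i] }
  have hχ : ∀ i h, (((χ i h : rootsOfUnity n Ω) : Ωˣ) : Ω) = (h : Ω ≃ₐ[F] Ω) (α i) / α i := by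
    intro i h
    simp [χ]
  have hker : ∀ i h, h ∈ (χ i).ker ↔ (h : Ω ≃ₐ[F] Ω) (α i) = α i := by
    intro i h
    rw [MonoidHom.mem_ker, ← div_eq_one_iff_eq (hα0 i), ← hχ]
    simp
  have hclosed : ∀ i, IsClosed ((χ i).ker : Set H) := by
    intro i
    have h1 := InfiniteGalois.fixingSubgroup_isClosed (IntermediateField.adjoin F {α i})
    convert h1.preimage (continuous_subtype_val : Continuous (Subtype.val : H → Ω ≃ₐ[F] Ω)) using 1
    ext h
    rw [SetLike.mem_coe, hker, Set.mem_preimage, SetLike.mem_coe,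
      IntermediateField.mem_fixingSubgroup_iff]
    constructor
    · intro h2 y hy
      have : IntermediateField.adjoin F {α i} ≤
          IntermediateField.fixedField (Subgroup.zpowers (h : Ω ≃ₐ[F] Ω)) := by
        rw [IntermediateField.adjoin_simple_le_iff]
        rintro ⟨m, hm⟩
        have h3 : Subgroup.zpowers (h : Ω ≃ₐ[F] Ω) ≤ MulAction.stabilizer _ (α i) := by
          rw [Subgroup.zpowers_le]; exact h2
        exact h3 hm
      exact this hy ⟨_, Subgroup.mem_zpowers _⟩
    · intro h2
      exact h2 _ (IntermediateField.mem_adjoin_simple_self F (α i))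
  have hcard : Nat.card (rootsOfUnity n Ω) ≤ n := card_rootsOfUnity Ω n
  choose d f hf hfk using fun i => exists_surj_of_cyclic n hcard (χ i)
  let S := Σ d : Fin n, cyclicKernels H ((d : ℕ) + 1)
  have hgen : ∀ s : S, ∃ σ : H, ∀ h : H, ∃ m : ℕ, (σ ^ m)⁻¹ * h ∈ s.2.1 := by
    rintro ⟨d, N, hNc, f, hf, rfl⟩
    obtain ⟨σ, hσ⟩ := hf (Multiplicative.ofAdd 1)
    refine ⟨σ, fun h => ⟨(Multiplicative.toAdd (f h)).val, ?_⟩⟩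
    rw [MonoidHom.mem_ker, map_mul, map_inv, map_pow, hσ, ← ofAdd_nsmul, nsmul_eq_mul,
      ZMod.natCast_zmod_val]
    simp
  choose σ hσ using hgen
  let s : Fin (n * k * n + 1) → S := fun i => ⟨d i, (χ i).ker, hclosed i, f i, hf i, hfk i⟩
  have hfinS : ∀ d : Fin n, Finite (cyclicKernels H ((d : ℕ) + 1)) := fun d =>
    (hk _ (Nat.succ_pos _) d.2).1
  have hcardS : Nat.card S ≤ n * k := by
    rw [Nat.card_sigma]
    calc _ ≤ ∑ d : Fin n, k := Finset.sum_le_sum fun d _ => (hk _ (Nat.succ_pos _) d.2).2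
      _ = n * k := by simp
  have hfinS' : Finite S := inferInstanceAs (Finite (Σ d : Fin n, _))
  let Φ : Fin (n * k * n + 1) → S × rootsOfUnity n Ω := fun i => (s i, χ i (σ (s i)))
  have hΦ : ¬ Function.Injective Φ := by
    intro hinj
    have h1 := Nat.card_le_card_of_injective Φ hinj
    rw [Nat.card_prod, Nat.card_fin] at h1
    have h2 := Nat.mul_le_mul hcardS hcard
    omega
  rw [Function.Injective] at hΦ
  push Not at hΦ
  obtain ⟨i, j, hΦij, hij⟩ := hΦ
  refine ⟨i, j, hij, ?_⟩
  have hs : s i = s j := congrArg Prod.fst hΦij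
  have hc : χ i (σ (s i)) = χ j (σ (s j)) := congrArg Prod.snd hΦij
  rw [← hs] at hc
  have hχij : ∀ h, χ i h = χ j h := by
    intro h
    obtain ⟨m, hm⟩ := hσ (s i) h
    have hmi : χ i ((σ (s i) ^ m)⁻¹ * h) = 1 := hm
    rw [hs] at hm
    have hmj : χ j ((σ (s j) ^ m)⁻¹ * h) = 1 := hm
    rw [← hs] at hmj
    rw [map_mul, map_inv, inv_mul_eq_one, map_pow] at hmi hmj
    rw [← hmi, ← hmj, hc]
  have hyE : α j / α i ∈ E := by
    rw [← InfiniteGalois.fixedField_fixingSubgroup E]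
    intro h
    have h1 := congrArg (fun u : rootsOfUnity n Ω => ((u : Ωˣ) : Ω)) (hχij h)
    simp only [hχ] at h1
    change (h : Ω ≃ₐ[F] Ω) (α j / α i) = α j / α i
    rw [map_div₀]
    have h2 : (h : Ω ≃ₐ[F] Ω) (α i) ≠ 0 := by simpa using hα0 i
    rw [div_eq_div_iff (hα0 i) (hα0 j)] at h1
    rw [div_eq_div_iff h2 (hα0 i)]
    linear_combination -h1
  refine ⟨⟨_, hyE⟩, Subtype.ext ?_⟩
  change (x i : Ω) * (α j / α i) ^ n = x j
  rw [← hα i, ← hα j, ← mul_pow, mul_div_cancel₀ _ (hα0 i)]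

end GaloisSide2

section ModelSide

open Polynomial FirstOrder.Language FirstOrder.Ring

/-- polynomial with given coefficients -/
noncomputable def PW {R : Type*} [CommRing R] {d : ℕ} (w : Fin d → R) : R[X] :=
  ∑ i, C (w i) * X ^ (i : ℕ)

lemma PW_map {R S : Type*} [CommRing R] [CommRing S] (f : R →+* S) {d : ℕ} (w : Fin d → R) :
    (PW w).map f = PW (fun i => f (w i)) := by
  simp [PW, Polynomial.map_sum]

lemma PW_degree_lt {R : Type*} [CommRing R] {d : ℕ} (w : Fin d → R) :
    (PW w).degree < d := by
  exact degree_sum_fin_lt w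

lemma exists_PW {R : Type*} [CommRing R] {d : ℕ} (f : R[X]) (hf : f.degree < d) :
    ∃ w : Fin d → R, PW w = f := by
  refine ⟨fun i => f.coeff i, ?_⟩
  unfold PW
  rw [Fin.sum_univ_eq_sum_range (fun i => C (f.coeff i) * X ^ i)]
  by_cases h0 : f = 0
  · simp [h0]
  · exact (as_sum_range_C_mul_X_pow' f ((natDegree_lt_iff_degree_lt h0).2 hf)).symm

/-- formula saying that two polynomials agree -/
noncomputable def polyEq {α : Type} (S T : (FreeCommRing α)[X]) : Language.ring.Formula α :=
  Formula.iInf (fun i : Fin (max S.natDegree T.natDegree + 1) =>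
    (termOfFreeCommRing (S.coeff i)).equal (termOfFreeCommRing (T.coeff i)))

lemma realize_polyEq {α : Type} (S T : (FreeCommRing α)[X]) {K : Type*} [Field K]
    [CompatibleRing K] (v : α → K) :
    (polyEq S T).Realize v ↔ S.map (FreeCommRing.lift v) = T.map (FreeCommRing.lift v) := by
  simp only [polyEq, Formula.realize_iInf, Formula.realize_equal, realize_termOfFreeCommRing]
  constructor
  · intro h
    ext i
    rw [coeff_map, coeff_map]
    by_cases hi : i < max S.natDegree T.natDegree + 1
    · exact h ⟨i, hi⟩
    · rw [coeff_eq_zero_of_natDegree_lt (p := S) (by omega),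
        coeff_eq_zero_of_natDegree_lt (p := T) (by omega)]
  · intro h i
    rw [← coeff_map, ← coeff_map, h]

/-- no factorisation -/
def IrrP {K : Type*} [Field K] {d : ℕ} (c : Fin d → K) : Prop :=
  ∀ f g : Fin d → K, PW f * PW g ≠ X ^ d + PW c

/-- congruence modulo n-th powers and modulo the polynomial -/
def RelP {K : Type*} [Field K] {d : ℕ} (n : ℕ) (c x x' : Fin d → K) : Prop :=
  ∃ (y : Fin d → K) (q : Fin (d * (n + 2)) → K),
    PW x * PW y ^ n - PW x' = (X ^ d + PW c) * PW q

/-- formula for IrrP -/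
noncomputable def irrF (ι : Type) (d : ℕ) : Language.ring.Formula (Fin d ⊕ ι × Fin d) :=
  Formula.iAlls (Fin d ⊕ Fin d)
    (∼(polyEq (α := (Fin d ⊕ ι × Fin d) ⊕ (Fin d ⊕ Fin d))
      (PW (fun a : Fin d => FreeCommRing.of (Sum.inr (Sum.inl a))) *
        PW (fun a : Fin d => FreeCommRing.of (Sum.inr (Sum.inr a))))
      (X ^ d + PW (fun a : Fin d => FreeCommRing.of (Sum.inl (Sum.inl a))))))

lemma realize_irrF (ι : Type) (d : ℕ) {K : Type*} [Field K] [CompatibleRing K]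
    (v : Fin d ⊕ ι × Fin d → K) :
    (irrF ι d).Realize v ↔ IrrP (fun a => v (Sum.inl a)) := by
  simp only [irrF, Formula.realize_iAlls, Formula.realize_not, realize_polyEq, IrrP,
    Polynomial.map_mul, Polynomial.map_add, Polynomial.map_pow, Polynomial.map_X, PW_map,
    FreeCommRing.lift_of, Sum.elim_inl, Sum.elim_inr]
  constructor
  · intro h f g
    exact h (Sum.elim f g)
  · intro h w
    exact h _ _

/-- formula for nonvanishing -/
noncomputable def nzF {ι : Type} (d : ℕ) (i : ι) : Language.ring.Formula (Fin d ⊕ ι × Fin d) :=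
  ∼(polyEq (α := (Fin d ⊕ ι × Fin d))
      (PW (fun a : Fin d => FreeCommRing.of (Sum.inr (i, a)))) 0)

lemma realize_nzF {ι : Type} (d : ℕ) (i : ι) {K : Type*} [Field K] [CompatibleRing K]
    (v : Fin d ⊕ ι × Fin d → K) :
    (nzF d i).Realize v ↔ PW (fun a => v (Sum.inr (i, a))) ≠ 0 := by
  simp only [nzF, Formula.realize_not, realize_polyEq, PW_map,
    FreeCommRing.lift_of, Polynomial.map_zero, ne_eq]

/-- formula for RelP -/
noncomputable def relF {ι : Type} (d n : ℕ) (i j : ι) :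
    Language.ring.Formula (Fin d ⊕ ι × Fin d) :=
  Formula.iExs (Fin d ⊕ Fin (d * (n + 2)))
    (polyEq (α := (Fin d ⊕ ι × Fin d) ⊕ (Fin d ⊕ Fin (d * (n + 2))))
      (PW (fun a : Fin d => FreeCommRing.of (Sum.inl (Sum.inr (i, a)))) *
        PW (fun a : Fin d => FreeCommRing.of (Sum.inr (Sum.inl a))) ^ n -
        PW (fun a : Fin d => FreeCommRing.of (Sum.inl (Sum.inr (j, a)))))
      ((X ^ d + PW (fun a : Fin d => FreeCommRing.of (Sum.inl (Sum.inl a)))) *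
        PW (fun a : Fin (d * (n + 2)) => FreeCommRing.of (Sum.inr (Sum.inr a)))))

lemma realize_relF {ι : Type} (d n : ℕ) (i j : ι) {K : Type*} [Field K] [CompatibleRing K]
    (v : Fin d ⊕ ι × Fin d → K) :
    (relF d n i j).Realize v ↔ RelP n (fun a => v (Sum.inl a))
      (fun a => v (Sum.inr (i, a))) (fun a => v (Sum.inr (j, a))) := by
  simp only [relF, Formula.realize_iExs, realize_polyEq, RelP, Polynomial.map_sub,
    Polynomial.map_mul, Polynomial.map_add, Polynomial.map_pow, Polynomial.map_X, PW_map,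
    FreeCommRing.lift_of, Sum.elim_inl, Sum.elim_inr]
  constructor
  · rintro ⟨w, hw⟩
    exact ⟨_, _, hw⟩
  · rintro ⟨y, q, h⟩
    exact ⟨Sum.elim y q, h⟩

open Classical in
/-- the basic formula -/
noncomputable def psiF {ι : Type} (d n : ℕ) (i j : ι) :
    Language.ring.Formula (Fin d ⊕ ι × Fin d) :=
  irrF ι d ⊓ nzF d i ⊓ (if i = j then ⊤ else ∼(relF d n i j))

/-- its meaning -/
def PsiP {K : Type*} [Field K] {d : ℕ} (n : ℕ) {ι : Type} (c : Fin d → K) (x : ι → Fin d → K)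
    (i j : ι) : Prop :=
  IrrP c ∧ PW (x i) ≠ 0 ∧ (i ≠ j → ¬ RelP n c (x i) (x j))

lemma realize_psiF {ι : Type} (d n : ℕ) (i j : ι) {K : Type*} [Field K] [CompatibleRing K]
    (v : Fin d ⊕ ι × Fin d → K) :
    (psiF d n i j).Realize v ↔
      PsiP n (fun a => v (Sum.inl a)) (fun i a => v (Sum.inr (i, a))) i j := by
  unfold psiF PsiP
  rw [Formula.realize_inf, Formula.realize_inf, realize_irrF, realize_nzF, and_assoc]
  by_cases h : i = j
  · simp [h]
  · simp [h, realize_relF]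

/-- `K` has a degree `d` extension with a family of elements independent mod `n`-th powers -/
def Bad (K : Type*) [Field K] (d n : ℕ) (ι : Type) : Prop :=
  ∃ E : IntermediateField K (AlgebraicClosure K), FiniteDimensional K E ∧
    Module.finrank K E = d ∧ ∃ x : ι → E, (∀ i, x i ≠ 0) ∧
      ∀ i j, i ≠ j → ∀ y : E, x i * y ^ n ≠ x j

lemma natDegree_mon {K : Type*} [Field K] {d : ℕ} (c : Fin d → K) :
    (X ^ d + PW c).natDegree = d := by
  apply natDegree_eq_of_degree_eq_some
  rw [degree_add_eq_left_of_degree_lt] <;> rw [degree_X_pow]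
  exact PW_degree_lt c

lemma monic_mon {K : Type*} [Field K] {d : ℕ} (c : Fin d → K) :
    (X ^ d + PW c).Monic := monic_X_pow_add (PW_degree_lt c)

lemma irrP_iff {K : Type*} [Field K] {d : ℕ} (hd : 0 < d) (c : Fin d → K) :
    IrrP c ↔ Irreducible (X ^ d + PW c) := by
  have hm := monic_mon c
  have hdeg := natDegree_mon c
  constructor
  · intro h
    rw [hm.irreducible_iff_natDegree]
    refine ⟨fun h1 => by rw [h1, natDegree_one] at hdeg; omega, ?_⟩
    intro f g hf hg hfg
    by_contra hcon
    push Not at hcon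
    have h1 := hf.natDegree_mul hg
    rw [hfg, hdeg] at h1
    obtain ⟨w, hw⟩ := exists_PW (d := d) f
      (by rw [degree_eq_natDegree hf.ne_zero]; exact_mod_cast (by omega))
    obtain ⟨w', hw'⟩ := exists_PW (d := d) g
      (by rw [degree_eq_natDegree hg.ne_zero]; exact_mod_cast (by omega))
    exact h w w' (by rw [hw, hw', hfg])
  · intro h f g hfg
    have hne : PW f * PW g ≠ 0 := by rw [hfg]; exact hm.ne_zero
    have hf0 := left_ne_zero_of_mul hne
    have hg0 := right_ne_zero_of_mul hne
    have h1 := natDegree_mul hf0 hg0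
    rw [hfg, hdeg] at h1
    have hf := (natDegree_lt_iff_degree_lt hf0).2 (PW_degree_lt f)
    have hg := (natDegree_lt_iff_degree_lt hg0).2 (PW_degree_lt g)
    rcases h.isUnit_or_isUnit hfg.symm with h2 | h2
    · have := natDegree_eq_zero_of_isUnit h2
      omega
    · have := natDegree_eq_zero_of_isUnit h2
      omega

lemma relP_iff {K : Type*} [Field K] {d : ℕ} (n : ℕ) (hd : 0 < d) (c x x' : Fin d → K) :
    RelP n c x x' ↔ ∃ y : K[X], (X ^ d + PW c) ∣ PW x * y ^ n - PW x' := by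
  have hm := monic_mon c
  have hdeg := natDegree_mon c
  constructor
  · rintro ⟨y, q, h⟩
    exact ⟨PW y, PW q, h⟩
  · rintro ⟨y, hy⟩
    set p := X ^ d + PW c with hp
    have h1 : (y %ₘ p).degree < d := by
      have := degree_modByMonic_lt y hm
      rwa [degree_eq_natDegree hm.ne_zero, hdeg] at this
    obtain ⟨w, hw⟩ := exists_PW _ h1
    have h2 : p ∣ PW x * PW w ^ n - PW x' := by
      have h3 : p ∣ y - y %ₘ p := by
        have := modByMonic_add_div y p
        exact ⟨y /ₘ p, by linear_combination -this⟩
      have h4 : p ∣ y ^ n - (y %ₘ p) ^ n := h3.trans (sub_dvd_pow_sub_pow _ _ n)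
      rw [hw]
      have h5 := dvd_sub hy (h4.mul_left (PW x))
      convert h5 using 1
      ring
    obtain ⟨q, hq⟩ := h2
    have hle : ∀ w : Fin d → K, (PW w).natDegree ≤ d := fun w =>
      natDegree_le_of_degree_le (PW_degree_lt w).le
    have h6 : (PW x * PW w ^ n - PW x').natDegree ≤ d * (n + 1) := by
      refine (natDegree_sub_le _ _).trans (max_le ?_ ?_)
      · refine natDegree_mul_le.trans ?_
        have h7 := (natDegree_pow_le (p := PW w) (n := n)).trans (Nat.mul_le_mul_left n (hle w))
        have h8 := hle x
        nlinarith
      · exact (hle x').trans (by nlinarith)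
    obtain ⟨q', hq'⟩ := exists_PW (d := d * (n + 2)) q (by
      by_cases hq0 : q = 0
      · rw [hq0, degree_zero]; exact WithBot.bot_lt_coe _
      · rw [← natDegree_lt_iff_degree_lt hq0]
        rw [hq, natDegree_mul hm.ne_zero hq0] at h6
        nlinarith)
    exact ⟨w, q', by rw [hq, hq']⟩

end ModelSide

section FieldSide

open Polynomial IntermediateField

lemma mem_adj_iff {K : Type*} [Field K] (θ : AlgebraicClosure K) (e : AlgebraicClosure K) :
    e ∈ K⟮θ⟯ ↔ ∃ f : K[X], aeval θ f = e := by
  rw [← IntermediateField.mem_toSubalgebra,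
    adjoin_simple_toSubalgebra_of_isAlgebraic (Algebra.IsAlgebraic.isAlgebraic θ),
    Algebra.adjoin_singleton_eq_range_aeval]
  rfl

lemma relP_iff_adj {K : Type*} [Field K] {d : ℕ} (n : ℕ) (hd : 0 < d) (c : Fin d → K)
    (θ : AlgebraicClosure K) (hmin : minpoly K θ = X ^ d + PW c) (x x' : Fin d → K) :
    RelP n c x x' ↔ ∃ y ∈ K⟮θ⟯, aeval θ (PW x) * y ^ n = aeval θ (PW x') := by
  rw [relP_iff n hd]
  constructor
  · rintro ⟨y, hy⟩
    refine ⟨aeval θ y, (mem_adj_iff θ _).2 ⟨y, rfl⟩, ?_⟩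
    rw [← hmin, minpoly.dvd_iff, map_sub, map_mul, map_pow, sub_eq_zero] at hy
    exact hy
  · rintro ⟨y, hy, h⟩
    obtain ⟨f, rfl⟩ := (mem_adj_iff θ _).1 hy
    refine ⟨f, ?_⟩
    rw [← hmin, minpoly.dvd_iff, map_sub, map_mul, map_pow, sub_eq_zero]
    exact h

lemma bad_iff {K : Type*} [Field K] [CharZero K] {d : ℕ} (n : ℕ) (hd : 0 < d) (ι : Type)
    [Nonempty ι] :
    Bad K d n ι ↔ ∃ (c : Fin d → K) (x : ι → Fin d → K), ∀ i j, PsiP n c x i j := by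
  constructor
  · rintro ⟨E, hfin, hdim, x, hx0, hx⟩
    obtain ⟨α, hα⟩ := Field.exists_primitive_element K E
    have hE : K⟮(α : AlgebraicClosure K)⟯ = E := by
      rw [← lift_adjoin_simple, hα, lift_top]
    obtain ⟨θ, rfl⟩ : ∃ θ : AlgebraicClosure K, K⟮θ⟯ = E := ⟨_, hE⟩
    have hint : IsIntegral K θ := (Algebra.IsAlgebraic.isAlgebraic θ).isIntegral
    rw [adjoin.finrank hint] at hdim
    have hmon := minpoly.monic hint
    have hdegm : (minpoly K θ).degree = d := by
      rw [degree_eq_natDegree hmon.ne_zero, hdim]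
    obtain ⟨c, hc⟩ := exists_PW (d := d) (minpoly K θ - X ^ d) (by
      have := degree_sub_lt_left (p := minpoly K θ) (q := X ^ d) (by rw [hdegm, degree_X_pow])
        hmon.ne_zero (by rw [hmon.leadingCoeff, (monic_X_pow d).leadingCoeff])
      rwa [hdegm] at this)
    have hmin : minpoly K θ = X ^ d + PW c := by rw [hc]; ring
    have hw : ∀ i, ∃ w : Fin d → K, aeval θ (PW w) = (x i : AlgebraicClosure K) := by
      intro i
      obtain ⟨f, hf⟩ := (mem_adj_iff θ _).1 (x i).2
      obtain ⟨w, hw⟩ := exists_PW (d := d) (f %ₘ minpoly K θ) (by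
        rw [← hdegm]; exact degree_modByMonic_lt _ hmon)
      refine ⟨w, ?_⟩
      rw [hw, aeval_modByMonic_eq_self_of_root (minpoly.aeval K θ), hf]
    choose w hw using hw
    refine ⟨c, w, fun i j => ⟨?_, ?_, ?_⟩⟩
    · rw [irrP_iff hd, ← hmin]
      exact minpoly.irreducible hint
    · intro h
      have := hw i
      rw [h, map_zero] at this
      exact hx0 i (Subtype.ext this.symm)
    · intro hij hrel
      rw [relP_iff_adj n hd c θ hmin] at hrel
      obtain ⟨y, hy, h⟩ := hrel
      rw [hw, hw] at h
      exact hx i j hij ⟨y, hy⟩ (Subtype.ext h)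
  · rintro ⟨c, x, h⟩
    obtain ⟨i₀⟩ := ‹Nonempty ι›
    have hirr := (irrP_iff hd c).1 (h i₀ i₀).1
    have hmon := monic_mon c
    have hnd := natDegree_mon c
    obtain ⟨θ, hθ⟩ := IsAlgClosed.exists_aeval_eq_zero (AlgebraicClosure K) (X ^ d + PW c)
      (by rw [degree_eq_natDegree hmon.ne_zero, hnd]; exact_mod_cast hd.ne')
    have hmin : minpoly K θ = X ^ d + PW c :=
      (minpoly.eq_of_irreducible_of_monic hirr hθ hmon).symm
    have hint : IsIntegral K θ := (Algebra.IsAlgebraic.isAlgebraic θ).isIntegral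
    refine ⟨K⟮θ⟯, adjoin.finiteDimensional hint, ?_, 
      fun i => ⟨aeval θ (PW (x i)), (mem_adj_iff θ _).2 ⟨_, rfl⟩⟩, ?_, ?_⟩
    · rw [adjoin.finrank hint, hmin, hnd]
    · intro i hi
      have h1 : aeval θ (PW (x i)) = 0 := congrArg Subtype.val hi
      have h2 := degree_le_of_dvd ((minpoly.dvd_iff).2 h1) (h i i).2.1
      rw [hmin, degree_eq_natDegree hmon.ne_zero, hnd] at h2
      exact absurd (PW_degree_lt (x i)) (not_lt.2 h2)
    · intro i j hij y hy
      refine (h i j).2.2 hij ?_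
      rw [relP_iff_adj n hd c θ hmin]
      exact ⟨y, y.2, congrArg Subtype.val hy⟩

end FieldSide

section Transfer

open FirstOrder.Language FirstOrder.Ring

lemma bad_iff_formula {K : Type*} [Field K] [CharZero K] [CompatibleRing K] {d : ℕ} (n : ℕ)
    (hd : 0 < d) (ι : Type) [Nonempty ι] :
    Bad K d n ι ↔ ∃ v : Fin d ⊕ ι × Fin d → K, ∀ i j : ι, (psiF d n i j).Realize v := by
  rw [bad_iff n hd]
  simp only [realize_psiF]
  constructor
  · rintro ⟨c, x, h⟩
    exact ⟨Sum.elim c (fun p => x p.1 p.2), h⟩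
  · rintro ⟨v, h⟩
    exact ⟨_, _, h⟩

/-- the sentence -/
noncomputable def badS (d n : ℕ) (ι : Type) [Finite ι] : Language.ring.Sentence :=
  Formula.iExs (α := Empty) (Fin d ⊕ ι × Fin d)
    ((Formula.iInf (fun p : ι × ι => psiF d n p.1 p.2)).relabel Sum.inr)

lemma bad_iff_sentence {K : Type*} [Field K] [CharZero K] [CompatibleRing K] {d : ℕ} (n : ℕ)
    (hd : 0 < d) (ι : Type) [Nonempty ι] [Finite ι] :
    Bad K d n ι ↔ K ⊨ badS d n ι := by
  rw [bad_iff_formula n hd, Sentence.Realize, badS, Formula.realize_iExs]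
  simp only [Formula.realize_relabel, Sum.elim_comp_inr, Formula.realize_iInf, Prod.forall]

lemma charZero_of_equiv {F F' : Type*} [Field F] [CharZero F] [CompatibleRing F] [Field F']
    [CompatibleRing F'] (h : F ≅[Language.ring] F') : CharZero F' := by
  have : CharP F 0 := CharP.ofCharZero F
  have h1 : (Theory.fieldOfChar 0).Model F := inferInstance
  have h2 : (Theory.fieldOfChar 0).Model F' := (h.theory_model_iff).1 h1
  have := FirstOrder.Field.charP_of_model_fieldOfChar 0 F'
  exact CharP.charP_to_charZero F'

lemma exists_bad_nat.{u, w} (F : Type u) [Field F] [CharZero F] [CompatibleRing F] {d : ℕ} (n : ℕ)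
    (hd : 0 < d) (h : ∀ k : ℕ, Bad F d n (Fin (k + 1))) :
    ∃ (F' : Type w) (_ : Field F') (_ : CompatibleRing F'), (F ≅[Language.ring] F') ∧
      Bad F' d n ℕ := by
  let V := Fin d ⊕ ℕ × Fin d
  let T : (Language.ring[[V]]).Theory := (Language.ring.lhomWithConstants V).onTheory
    (Language.ring.completeTheory F)
  let A : ℕ × ℕ → (Language.ring[[V]]).Theory := fun p =>
    T ∪ {Formula.equivSentence (psiF d n p.1 p.2)}
  have hsat : Theory.IsSatisfiable (⋃ p, A p) := by
    rw [Theory.isSatisfiable_iUnion_iff_isSatisfiable_iUnion_finset]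
    intro s
    obtain ⟨k, hk⟩ : ∃ k, ∀ p ∈ s, p.1 ≤ k ∧ p.2 ≤ k := by
      refine ⟨s.sup (fun p => max p.1 p.2), fun p hp => ?_⟩
      have := Finset.le_sup (f := fun p : ℕ × ℕ => max p.1 p.2) hp
      exact ⟨(le_max_left _ _).trans this, (le_max_right _ _).trans this⟩
    obtain ⟨c, x, hcx⟩ := (bad_iff n hd (Fin (k + 1))).1 (h k)
    let v : V → F := Sum.elim c (fun p => x (Fin.ofNat (k + 1) p.1) p.2)
    let : (constantsOn V).Structure F := constantsOn.structure v
    have hmod : F ⊨ (⋃ p ∈ s, A p) := by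
      rw [Theory.model_iff]
      intro φ hφ
      simp only [Set.mem_iUnion] at hφ
      obtain ⟨p, hp, hφ⟩ := hφ
      rcases hφ with hφ | hφ
      · have : F ⊨ T := (LHom.onTheory_model _ _).2 inferInstance
        exact this.realize_of_mem φ hφ
      · rw [Set.mem_singleton_iff] at hφ
        rw [hφ, Formula.realize_equivSentence]
        change (psiF d n p.1 p.2).Realize v
        rw [realize_psiF]
        obtain ⟨h1, h2, h3⟩ := hcx (Fin.ofNat (k + 1) p.1) (Fin.ofNat (k + 1) p.2)
        refine ⟨h1, h2, fun hne => h3 ?_⟩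
        intro heq
        apply hne
        have h4 := congrArg Fin.val heq
        obtain ⟨h5, h6⟩ := hk p hp
        simpa [Fin.ofNat, Nat.mod_eq_of_lt (Nat.lt_succ_of_le h5),
          Nat.mod_eq_of_lt (Nat.lt_succ_of_le h6)] using h4
    exact Theory.Model.isSatisfiable F
  obtain ⟨M0⟩ := hsat
  let M := Theory.ModelType.ulift.{0, 0, 0, w} M0
  let : Language.ring.Structure M := (Language.ring.lhomWithConstants V).reduct M
  have : (Language.ring.lhomWithConstants V).IsExpansionOn M := LHom.isExpansionOn_reduct _ _
  have hA : ∀ p, ∀ φ ∈ A p, M ⊨ φ := fun p φ hφ =>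
    M.is_model.realize_of_mem φ (Set.mem_iUnion.2 ⟨p, hφ⟩)
  have hT : M ⊨ T := ⟨fun φ hφ => hA (0, 0) φ (Or.inl hφ)⟩
  have hT' : M ⊨ Language.ring.completeTheory F := (LHom.onTheory_model _ _).1 hT
  have heq : F ≅[Language.ring] M := by
    rw [elementarilyEquivalent_iff]
    intro φ
    constructor
    · intro hφ
      exact hT'.realize_of_mem φ hφ
    · intro hφ
      by_contra hcon
      have := hT'.realize_of_mem (∼φ) (by
        rw [mem_completeTheory]; exact (Sentence.realize_not F).2 hcon)
      exact (Sentence.realize_not M).1 this hφ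
  have : Theory.field.Model M := (heq.theory_model_iff).1 inferInstance
  let := FirstOrder.Field.fieldOfModelField M
  let := FirstOrder.Field.compatibleRingOfModelField M
  refine ⟨M, inferInstance, inferInstance, heq, ?_⟩
  have : CharZero M := charZero_of_equiv heq
  rw [bad_iff_formula n hd]
  refine ⟨fun a => (Language.ring.con a : M), fun i j => ?_⟩
  have := hA (i, j) _ (Or.inr rfl)
  exact (Formula.realize_equivSentence M _).1 this

end Transfer

lemma smallQ_of_not_bad {F : Type*} [Field F] (E : IntermediateField F (AlgebraicClosure F))
    [FiniteDimensional F E] (n k : ℕ) (h : ¬ Bad F (Module.finrank F E) n (Fin (k + 1))) :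
    SmallQ E n k := by
  intro x hx
  by_contra hcon
  push Not at hcon
  exact h ⟨E, inferInstance, rfl, x, hx, fun i j hij y => hcon i j hij y⟩

/-- For a field `F` of characteristic zero containing all roots of unity, the absolute Galois
group of `F` satisfies the uniform condition (G2*) if and only if every field `F'` elementarily
equivalent to `F` (in the first-order language of rings) satisfies (F2). -/
theorem stmt13 (F : Type*) [Field F] [CharZero F] [Ring.CompatibleRing F]
    (hμ : ∀ n : ℕ, 0 < n → ∃ ζ : F, IsPrimitiveRoot ζ n) :
    CondG2Star (AlgebraicClosure F ≃ₐ[F] AlgebraicClosure F) ↔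
      ∀ (F' : Type*) [Field F'] [Ring.CompatibleRing F'],
        F ≅[Language.ring] F' → CondF2 F' := by
  constructor
  · intro hG F' _ _ heq n hn E hfin
    by_contra hinf
    rw [not_finite_iff_infinite] at hinf
    have : CharZero F' := charZero_of_equiv heq
    set d := Module.finrank F' E with hd
    have hd0 : 0 < d := Module.finrank_pos
    have hbad : ∀ k : ℕ, Bad F' d n (Fin (k + 1)) := by
      intro k
      refine ⟨E, hfin, rfl, fun i => ((Quotient.out (Infinite.natEmbedding _ (i : ℕ) :
        Eˣ ⧸ (powMonoidHom n : Eˣ →* Eˣ).range) : Eˣ) : E), fun i => Units.ne_zero _, ?_⟩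
      intro i j hij y hy
      apply hij
      apply Fin.ext
      apply (Infinite.natEmbedding (Eˣ ⧸ (powMonoidHom n : Eˣ →* Eˣ).range)).injective
      have hy0 : y ≠ 0 := by
        rintro rfl
        rw [zero_pow hn.ne', mul_zero] at hy
        exact Units.ne_zero _ hy.symm
      rw [← QuotientGroup.out_eq' (Infinite.natEmbedding _ (i : ℕ)),
        ← QuotientGroup.out_eq' (Infinite.natEmbedding _ (j : ℕ)), QuotientGroup.eq]
      refine ⟨Units.mk0 y hy0, ?_⟩
      rw [eq_inv_mul_iff_mul_eq]
      exact Units.ext hy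
    choose! k hk using fun (n' : ℕ) (h : 0 < n') => hG n' d h
    obtain ⟨ζ, hζ⟩ := hμ n hn
    set K := (Finset.range (n + 1)).sup k with hK
    have hb := (bad_iff_sentence n hd0 (Fin (n * K * n + 1))).1 (hbad (n * K * n))
    have hb' := (bad_iff_sentence n hd0 (Fin (n * K * n + 1))).2 ((Language.elementarilyEquivalent_iff.1 heq _).2 hb)
    obtain ⟨E', hE'fin, hE'd, x, hx0, hx⟩ := hb'
    have hS : SmallQ E' n (n * K * n) := by
      refine smallQ_of_cyclicKernels E' n hn ζ hζ K fun n' hn' hle => ?_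
      obtain ⟨h1, h2⟩ := hk n' hn' E'.fixingSubgroup
        (IntermediateField.fixingSubgroup_isOpen E')
        (by rw [← IntermediateField.finrank_eq_fixingSubgroup_index, hE'd])
      exact ⟨h1, h2.trans (Finset.le_sup (f := k) (Finset.mem_range.2 (Nat.lt_succ_of_le hle)))⟩
    obtain ⟨i, j, hij, y, hy⟩ := hS x hx0
    exact hx i j hij y hy
  · intro hF n m hn
    have hex : ∀ d : ℕ, 0 < d → ∃ k : ℕ, ¬ Bad F d n (Fin (k + 1)) := by
      intro d hd
      by_contra hcon
      push Not at hcon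
      obtain ⟨F', _, _, heq, E, hfin, -, x, hx0, hx⟩ := exists_bad_nat F n hd hcon
      have hQ := hF F' heq n hn E hfin
      let φ : ℕ → Eˣ ⧸ (powMonoidHom n : Eˣ →* Eˣ).range := fun i =>
        QuotientGroup.mk (Units.mk0 (x i) (hx0 i))
      have hφ : Function.Injective φ := by
        intro i j hij
        by_contra hne
        have h1 := QuotientGroup.eq.1 hij
        obtain ⟨y, hy⟩ := h1
        rw [eq_inv_mul_iff_mul_eq] at hy
        exact hx i j hne (y : E) (congrArg Units.val hy)
      exact not_injective_infinite_finite φ hφ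
    choose! k hk using hex
    obtain ⟨ζ, hζ⟩ := hμ n hn
    refine ⟨(Finset.range (m + 1)).sup k, fun H hH hm => ?_⟩
    have hHc : IsClosed (H : Set (AlgebraicClosure F ≃ₐ[F] AlgebraicClosure F)) :=
      H.isClosed_of_isOpen hH
    have hfix : (IntermediateField.fixedField H).fixingSubgroup = H :=
      InfiniteGalois.fixingSubgroup_fixedField ⟨H, hHc⟩
    have hfin : FiniteDimensional F (IntermediateField.fixedField H) := by
      rw [← InfiniteGalois.isOpen_iff_finite, hfix]
      exact hH
    have hrank := IntermediateField.finrank_eq_fixingSubgroup_index (AlgebraicClosure F)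
      (IntermediateField.fixedField H)
    rw [hfix] at hrank
    have hpos : 0 < Module.finrank F (IntermediateField.fixedField H) := Module.finrank_pos
    obtain ⟨h1, h2⟩ := cyclicKernels_bound H hHc n hn ζ hζ _
      (smallQ_of_not_bad (IntermediateField.fixedField H) n _ (hk _ hpos))
    exact ⟨h1, h2.trans (Finset.le_sup (f := k) (Finset.mem_range.2 (by omega)))⟩
end

section
/- Let (F,v) be a henselian valued field with residue field Fv of characteristic 0 containing all roots of unity, and value group Γ with [Γ : pΓ] finite for all primes p. Then F satisfies (F2) (for every n and every finite extension E/F, E^×/(E^×)^n is finite) if and only if Fv satisfies (F2). -/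
open Polynomial IsLocalRing

set_option linter.unusedSectionVars false

section General
variable {O F Ω : Type*} [CommRing O] [IsDomain O] [ValuationRing O] [HenselianLocalRing O]
  [Field F] [Algebra O F] [IsFractionRing O F]
  [Field Ω] [Algebra F Ω] [Algebra O Ω] [IsScalarTower O F Ω] [IsAlgClosed Ω] [IsGalois F Ω]
  [FaithfulSMul O Ω]

/-- Galois action on the integral closure. -/
noncomputable def actB (σ : Ω ≃ₐ[F] Ω) : integralClosure O Ω ≃ₐ[O] integralClosure O Ω :=
  AlgEquiv.mapIntegralClosure (σ.restrictScalars O)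

theorem actB_coe (σ : Ω ≃ₐ[F] Ω) (x : integralClosure O Ω) :
    ((actB σ x : integralClosure O Ω) : Ω) = σ x := rfl

theorem algebraMap_B_inj : Function.Injective (algebraMap O (integralClosure O Ω)) := by
  have h : Function.Injective (algebraMap O Ω) := FaithfulSMul.algebraMap_injective _ _
  intro a b hab
  exact h (congrArg (algebraMap (integralClosure O Ω) Ω) hab)

theorem exists_factor (h : O[X]) (hm : h.Monic) :
    ∃ s : Multiset (integralClosure O Ω),
      h.map (algebraMap O (integralClosure O Ω)) = (s.map (fun z => X - C z)).prod := by
  have hsp := IsAlgClosed.splits (h.map (algebraMap O Ω))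
  have h1 := hsp.eq_prod_roots
  rw [(hm.map _).leadingCoeff, C_1, one_mul] at h1
  have hint : ∀ z ∈ (h.map (algebraMap O Ω)).roots, z ∈ integralClosure O Ω := by
    intro z hz
    refine ⟨h, hm, ?_⟩
    have := (mem_roots'.1 hz).2
    rwa [IsRoot.def, eval_map] at this
  obtain ⟨s, hs⟩ : ∃ s : Multiset (integralClosure O Ω),
      s.map (algebraMap (integralClosure O Ω) Ω) = (h.map (algebraMap O Ω)).roots := by
    refine ⟨(h.map (algebraMap O Ω)).roots.pmap (fun z hz => ⟨z, hz⟩) hint, ?_⟩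
    rw [Multiset.map_pmap]
    exact (Multiset.pmap_eq_map _ _ _ _).trans (Multiset.map_id _)
  refine ⟨s, ?_⟩
  apply map_injective (algebraMap (integralClosure O Ω) Ω) Subtype.val_injective
  rw [Polynomial.map_map, ← IsScalarTower.algebraMap_eq, h1, ← hs, Polynomial.map_multiset_prod,
    Multiset.map_map, Multiset.map_map]
  congr 1
  apply Multiset.map_congr rfl
  intro z _
  simp

variable (F) in
theorem conj_of_root (y z : integralClosure O Ω) (hz : aeval z (minpoly O y) = 0) :
    ∃ σ : Ω ≃ₐ[F] Ω, actB σ y = z := by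
  have hy : IsIntegral O y := (IsIntegralClosure.isIntegral_algebra O Ω).isIntegral y
  have h1 := minpoly.isIntegrallyClosed_eq_field_fractions F Ω hy
  have : aeval (z : Ω) (minpoly F (y : Ω)) = 0 := by
    change aeval (z : Ω) (minpoly F (algebraMap (integralClosure O Ω) Ω y)) = 0
    rw [h1, aeval_map_algebraMap]
    have := congrArg (algebraMap (integralClosure O Ω) Ω) hz
    rwa [map_zero, ← aeval_algebraMap_apply] at this
  obtain ⟨σ, hσ⟩ := minpoly.exists_algEquiv_of_root' (Algebra.IsAlgebraic.isAlgebraic _) this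
  exact ⟨σ, Subtype.ext hσ⟩

variable (F) in
theorem isLocalRing_B [CharZero F] : IsLocalRing (integralClosure O Ω) := by
  classical
  apply IsLocalRing.of_isUnit_or_isUnit_one_sub_self
  intro x
  by_contra hcon
  push Not at hcon
  obtain ⟨hx0, hx1⟩ := hcon
  obtain ⟨M, hM⟩ := Ideal.exists_maximal (integralClosure O Ω)
  have hMp := hM.isPrime
  have hInt : Algebra.IsIntegral O (integralClosure O Ω) := IsIntegralClosure.isIntegral_algebra O Ω
  have hMO : M.comap (algebraMap O (integralClosure O Ω)) = maximalIdeal O :=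
    IsLocalRing.eq_maximalIdeal (Ideal.isMaximal_comap_of_isIntegral_of_isMaximal M)
  have hmem : ∀ a : O, algebraMap O (integralClosure O Ω) a ∈ M ↔ a ∈ maximalIdeal O := by
    intro a; rw [← hMO, Ideal.mem_comap]
  have hxi : IsIntegral O x := hInt.isIntegral x
  obtain ⟨s, hs⟩ := exists_factor (Ω := Ω) (minpoly O x) (minpoly.monic hxi)
  have hroot : ∀ z, z ∈ s ↔ aeval z (minpoly O x) = 0 := by
    intro z
    rw [← eval_map_algebraMap, hs, eval_multiset_prod, Multiset.map_map, Multiset.prod_eq_zero_iff,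
      Multiset.mem_map]
    simp [sub_eq_zero]
  have hconj : ∀ z ∈ s, ∀ σ : Ω ≃ₐ[F] Ω, actB σ z ∈ s := by
    intro z hz σ
    rw [hroot] at hz ⊢
    rw [aeval_algHom_apply, hz, map_zero]
  have hev : ∀ (h : O[X]) (t : Multiset (integralClosure O Ω)),
      h.map (algebraMap O (integralClosure O Ω)) = (t.map (fun z => X - C z)).prod →
      ∀ a : O, algebraMap O (integralClosure O Ω) (h.eval a) =
        (t.map (fun z => algebraMap O (integralClosure O Ω) a - z)).prod := by
    intro h t ht a
    rw [← eval₂_at_apply, ← eval_map, ht, eval_multiset_prod, Multiset.map_map]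
    simp
  have hkey : ∀ a : O, ¬ IsUnit (x - algebraMap O _ a) →
      ∃ z ∈ s, algebraMap O (integralClosure O Ω) a - z ∈ M := by
    intro a ha
    have h1 : x - algebraMap O _ a ∣ algebraMap O (integralClosure O Ω) ((minpoly O x).eval a) := by
      have := sub_dvd_eval_sub x (algebraMap O _ a) ((minpoly O x).map (algebraMap O (integralClosure O Ω)))
      rw [eval_map_algebraMap, minpoly.aeval, zero_sub, dvd_neg, eval_map, eval₂_at_apply] at this
      exact this
    have h2 : (minpoly O x).eval a ∈ maximalIdeal O := by
      rw [mem_maximalIdeal, mem_nonunits_iff]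
      intro hu
      exact ha (isUnit_of_dvd_unit h1 (hu.map _))
    rw [← hmem, hev _ _ hs, hMp.multiset_prod_mem_iff_exists_mem] at h2
    obtain ⟨w, hw, hw'⟩ := h2
    obtain ⟨z, hz, rfl⟩ := Multiset.mem_map.1 hw
    exact ⟨z, hz, hw'⟩
  obtain ⟨z0, hz0s, hz0⟩ := hkey 0 (by simpa using hx0)
  obtain ⟨z1, hz1s, hz1⟩ := hkey 1 (by rw [map_one, IsUnit.sub_iff]; exact hx1)
  simp only [map_zero, zero_sub, neg_mem_iff, map_one] at hz0 hz1
  have hz1M : z1 ∉ M := fun h => hMp.ne_top ((Ideal.eq_top_iff_one _).2 (by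
    have := M.add_mem hz1 h; simpa using this))
  set R := s.toFinset.filter (fun z => z ∉ M) with hR
  set y := ∏ z ∈ R, z with hy
  have hyM : y ∉ M := by
    rw [hy, hMp.prod_mem_iff]
    rintro ⟨i, hi, hi'⟩
    exact (Finset.mem_filter.1 hi).2 hi'
  have hσy : ∀ σ : Ω ≃ₐ[F] Ω, actB σ y = y ∨ actB σ y ∈ M := by
    intro σ
    by_cases hex : ∃ z ∈ R, actB σ z ∈ M
    · right
      rw [hy, map_prod, hMp.prod_mem_iff]
      exact hex
    · left
      push Not at hex
      have himg : R.image (actB σ) = R := by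
        apply Finset.eq_of_subset_of_card_le
        · intro w hw
          obtain ⟨z, hz, rfl⟩ := Finset.mem_image.1 hw
          refine Finset.mem_filter.2 ⟨?_, hex z hz⟩
          rw [Multiset.mem_toFinset]
          exact hconj z (Multiset.mem_toFinset.1 (Finset.mem_filter.1 hz).1) σ
        · rw [Finset.card_image_of_injective _ (actB σ).injective]
      rw [hy, map_prod]
      conv_rhs => rw [← himg, Finset.prod_image (fun a _ b _ h => (actB σ).injective h)]
  obtain ⟨τ, hτ⟩ : ∃ τ : Ω ≃ₐ[F] Ω, actB τ y ∈ M := by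
    obtain ⟨σ0, h0⟩ := conj_of_root F x z0 ((hroot _).1 hz0s)
    obtain ⟨σ1, h1⟩ := conj_of_root F x z1 ((hroot _).1 hz1s)
    refine ⟨σ1.symm.trans σ0, ?_⟩
    have e : actB (σ1.symm.trans σ0) z1 = z0 := by
      apply Subtype.ext
      rw [actB_coe, ← h1, ← h0, actB_coe, actB_coe]
      simp
    rw [hy, map_prod, hMp.prod_mem_iff]
    refine ⟨z1, Finset.mem_filter.2 ⟨Multiset.mem_toFinset.2 hz1s, hz1M⟩, ?_⟩
    rw [e]; exact hz0
  have hyi : IsIntegral O y := hInt.isIntegral y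
  set h := minpoly O y with hh
  obtain ⟨t, ht⟩ := exists_factor (Ω := Ω) h (minpoly.monic hyi)
  have hroot' : ∀ z, z ∈ t ↔ aeval z h = 0 := by
    intro z
    rw [← eval_map_algebraMap, ht, eval_multiset_prod, Multiset.map_map, Multiset.prod_eq_zero_iff,
      Multiset.mem_map]
    simp [sub_eq_zero]
  have htn : t.Nodup := by
    have h1 := minpoly.isIntegrallyClosed_eq_field_fractions F Ω hyi
    have hirr := minpoly.irreducible (Algebra.IsIntegral.isIntegral (R := F) (algebraMap (integralClosure O Ω) Ω y))
    have hsep := hirr.separable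
    have hsep2 := hsep.map (f := algebraMap F Ω)
    rw [h1, Polynomial.map_map, ← IsScalarTower.algebraMap_eq,
      IsScalarTower.algebraMap_eq O (integralClosure O Ω) Ω, ← Polynomial.map_map, ← hh, ht,
      Polynomial.map_multiset_prod, Multiset.map_map] at hsep2
    have := nodup_roots hsep2
    have e : Multiset.map (map (algebraMap (integralClosure O Ω) Ω) ∘ fun z ↦ X - C z) t
      = (t.map (algebraMap (integralClosure O Ω) Ω)).map (fun z => X - C z) := by
      rw [Multiset.map_map]
      apply Multiset.map_congr rfl
      intro z _
      simp
    rw [e, roots_multiset_prod_X_sub_C] at this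
    exact Multiset.Nodup.of_map _ this
  have hyt : y ∈ t := (hroot' y).2 (minpoly.aeval _ _)
  obtain ⟨t', rfl⟩ := Multiset.exists_cons_of_mem hyt
  rw [Multiset.nodup_cons] at htn
  have ht'M : ∀ z ∈ t', z ∈ M := by
    intro z hz
    obtain ⟨σ, rfl⟩ := conj_of_root F y z ((hroot' z).1 (Multiset.mem_cons_of_mem hz))
    rcases hσy σ with h | h
    · rw [h] at hz; exact absurd hz htn.1
    · exact h
  have hsum : t'.sum ∈ M := M.multiset_sum_mem _ ht'M
  have hc : algebraMap O (integralClosure O Ω) (-h.nextCoeff) = y + t'.sum := by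
    have := congrArg nextCoeff ht
    rw [multiset_prod_X_sub_C_nextCoeff, nextCoeff_map (algebraMap_B_inj)] at this
    rw [map_neg, this]; simp
  set c := -h.nextCoeff
  have hc1 : h.eval c ∈ maximalIdeal O := by
    rw [← hmem, hev _ _ ht, Multiset.map_cons, Multiset.prod_cons, hc]
    apply M.mul_mem_right
    simpa using hsum
  have hdy : eval y (derivative (h.map (algebraMap O (integralClosure O Ω)))) ∉ M := by
    rw [ht, eval_multiset_prod_X_sub_C_derivative (Multiset.mem_cons_self y t'), Multiset.erase_cons_head,
      hMp.multiset_prod_mem_iff_exists_mem]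
    rintro ⟨w, hw, hw'⟩
    obtain ⟨z, hz, rfl⟩ := Multiset.mem_map.1 hw
    apply hyM
    have := M.add_mem hw' (ht'M z hz)
    simpa using this
  have hc2 : IsUnit ((derivative h).eval c) := by
    by_contra hu
    rw [← mem_nonunits_iff, ← mem_maximalIdeal, ← hmem] at hu
    apply hdy
    have h1 := sub_dvd_eval_sub (algebraMap O _ c) y ((derivative h).map (algebraMap O (integralClosure O Ω)))
    have h2 : algebraMap O _ c - y ∈ M := by rw [hc]; simpa using hsum
    have h3 := M.mem_of_dvd h1 h2
    rw [eval_map, eval₂_at_apply] at h3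
    rw [derivative_map]
    have := M.sub_mem hu h3
    simpa using this
  obtain ⟨a, ha, -⟩ := HenselianLocalRing.is_henselian h (minpoly.monic hyi) c hc1 hc2
  obtain ⟨σ, hσ⟩ := conj_of_root F y (algebraMap O _ a) (by
    rw [aeval_algebraMap_apply, ← hh, coe_aeval_eq_eval, ha.eq_zero, map_zero])
  have : y = algebraMap O _ a := by
    rw [← AlgEquiv.commutes (actB σ)] at hσ
    exact (actB σ).injective hσ
  rw [this, AlgEquiv.commutes, ← this] at hτ
  exact hyM hτ

theorem exists_min_rel {ι A : Type*} (r : A → A → Prop) (hrefl : ∀ a, r a a)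
    (htot : ∀ a b, r a b ∨ r b a) (htr : ∀ a b c, r a b → r b c → r a c) (f : ι → A)
    (s : Finset ι) (hs : s.Nonempty) : ∃ i ∈ s, ∀ j ∈ s, r (f i) (f j) := by
  classical
  induction hs using Finset.Nonempty.cons_induction with
  | singleton a => exact ⟨a, by simp, by simp [hrefl]⟩
  | cons a s ha hs ih =>
    obtain ⟨i, hi, hij⟩ := ih
    rcases htot (f a) (f i) with h | h
    · refine ⟨a, by simp, fun j hj => ?_⟩
      rcases Finset.mem_cons.1 hj with rfl | hj
      · exact hrefl _
      · exact htr _ _ _ h (hij j hj)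
    · refine ⟨i, by simp [hi], fun j hj => ?_⟩
      rcases Finset.mem_cons.1 hj with rfl | hj
      · exact h
      · exact hij j hj

theorem dich_aux [IsLocalRing (integralClosure O Ω)] (x : Ω) : ∀ (n : ℕ) (p : (integralClosure O Ω)[X]),
    p.natDegree ≤ n → aeval x p = 0 → (∃ i, IsUnit (p.coeff i)) →
    x ∈ integralClosure O Ω ∨ x⁻¹ ∈ integralClosure O Ω := by
  intro n
  induction n with
  | zero =>
    rintro p hp hx ⟨i, hi⟩
    rw [eq_C_of_natDegree_le_zero hp] at hx hi
    rw [aeval_C] at hx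
    have : p.coeff 0 = 0 := Subtype.ext hx
    rw [this] at hi
    simp at hi
  | succ n ih =>
    rintro p hp hx ⟨i, hi⟩
    have hint : ∀ b : Ω, IsIntegral (integralClosure O Ω) b → b ∈ integralClosure O Ω := by
      intro b hb
      have hI : Algebra.IsIntegral O (integralClosure O Ω) := IsIntegralClosure.isIntegral_algebra O Ω
      exact isIntegral_trans b hb
    by_cases hd : p.natDegree ≤ n
    · exact ih p hd hx ⟨i, hi⟩
    have hdeg : p.natDegree = n + 1 := by omega
    have h1 : p.leadingCoeff • x ∈ integralClosure O Ω := hint _ (isIntegral_leadingCoeff_smul p x hx)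
    set a := p.leadingCoeff with ha
    obtain ⟨b, hb⟩ : ∃ b : integralClosure O Ω, (b : Ω) = (a : Ω) * x := ⟨⟨_, h1⟩, rfl⟩
    have hinv : ∀ u : integralClosure O Ω, IsUnit u → ((u : Ω))⁻¹ ∈ integralClosure O Ω := by
      rintro _ ⟨u, rfl⟩
      have : ((u : integralClosure O Ω) : Ω) * ((u⁻¹ : (integralClosure O Ω)ˣ) : integralClosure O Ω) = 1 := by
        rw [← MulMemClass.coe_mul, Units.mul_inv]; rfl
      rw [inv_eq_of_mul_eq_one_right this]
      exact Subtype.property _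
    have hne : ∀ u : integralClosure O Ω, IsUnit u → (u : Ω) ≠ 0 := by
      intro u hu h0
      have : u = 0 := Subtype.ext h0
      rw [this] at hu; simp at hu
    by_cases hau : IsUnit a
    · left
      have := mul_mem (hinv a hau) b.2
      rwa [hb, inv_mul_cancel_left₀ (hne a hau)] at this
    by_cases hbu : IsUnit b
    · right
      have := mul_mem a.2 (hinv b hbu)
      have hb0 := hne b hbu
      rw [hb] at this hb0
      have ha0 := left_ne_zero_of_mul hb0
      have e : (a : Ω) * (a * x)⁻¹ = x⁻¹ := by
        rw [mul_inv, mul_inv_cancel_left₀ ha0]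
      rwa [e] at this
    refine ih (p.eraseLead + C b * X ^ n) ?_ ?_ ?_
    · refine (natDegree_add_le _ _).trans (max_le ?_ (natDegree_C_mul_X_pow_le _ _))
      have := eraseLead_natDegree_le p
      omega
    · have h2 := eraseLead_add_C_mul_X_pow p
      rw [← h2, hdeg] at hx
      simp only [map_add, map_mul, aeval_C, map_pow, aeval_X] at hx ⊢
      rw [← hx]
      congr 1
      change (b : Ω) * x ^ n = (a : Ω) * x ^ (n + 1)
      rw [hb]; ring
    · have hin : i ≠ n + 1 := by
        rintro rfl
        apply hau
        rw [ha, leadingCoeff, hdeg]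
        exact hi
      refine ⟨i, ?_⟩
      rw [coeff_add, coeff_C_mul_X_pow, eraseLead_coeff_of_ne _ (by rw [hdeg]; exact hin)]
      split_ifs with h
      · by_contra hc
        have h3 := (IsLocalRing.nonunits_add (a := p.coeff i + b) (b := -b) hc (by
          rw [mem_nonunits_iff, IsUnit.neg_iff]; exact hbu))
        rw [add_neg_cancel_right] at h3
        exact h3 hi
      · rwa [add_zero]

theorem dich [Algebra.IsAlgebraic O Ω] [IsLocalRing (integralClosure O Ω)] (x : Ω) :
    x ∈ integralClosure O Ω ∨ x⁻¹ ∈ integralClosure O Ω := by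
  have hx : IsAlgebraic O x := Algebra.IsAlgebraic.isAlgebraic x
  obtain ⟨p, hp, hpx⟩ := hx
  obtain ⟨i, hi, hij⟩ := exists_min_rel (A := O) (· ∣ ·) dvd_refl (ValuationRing.dvd_total)
    (fun a b c => dvd_trans) p.coeff p.support (support_nonempty.2 hp)
  have hd : C (p.coeff i) ∣ p := by
    rw [C_dvd_iff_dvd_coeff]
    intro j
    by_cases hj : j ∈ p.support
    · exact hij j hj
    · rw [notMem_support_iff.1 hj]; exact dvd_zero _
  obtain ⟨q, hq⟩ := hd
  have hci : p.coeff i ≠ 0 := mem_support_iff.1 hi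
  have hqi : q.coeff i = 1 := by
    have := congrArg (fun r => coeff r i) hq
    simp only [coeff_C_mul] at this
    exact mul_left_cancel₀ hci (by rw [← this, mul_one])
  have hqx : aeval x q = 0 := by
    rw [hq, map_mul, aeval_C] at hpx
    refine (mul_eq_zero.1 hpx).resolve_left ?_
    exact fun h => hci ((FaithfulSMul.algebraMap_eq_zero_iff O Ω).1 h)
  refine dich_aux x _ (q.map (algebraMap O (integralClosure O Ω))) le_rfl ?_ ⟨i, ?_⟩
  · rw [aeval_map_algebraMap, hqx]
  · rw [coeff_map, hqi, map_one]; exact isUnit_one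

instance isLocalHom_B : IsLocalHom (algebraMap O (integralClosure O Ω)) := by
  have hI : Algebra.IsIntegral O (integralClosure O Ω) := IsIntegralClosure.isIntegral_algebra O Ω
  exact (algebraMap_isIntegral_iff.mpr hI).isLocalHom algebraMap_B_inj

theorem actB_residue [IsLocalRing (integralClosure O Ω)] (σ : Ω ≃ₐ[F] Ω) (b : integralClosure O Ω)
    (hb : residue _ b = 1) : residue _ (actB σ b) = 1 := by
  rw [← sub_eq_zero, ← map_one (residue _), ← map_sub, residue_eq_zero_iff, mem_maximalIdeal,
    mem_nonunits_iff] at hb ⊢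
  intro h
  apply hb
  rw [← map_one (actB (O := O) σ), ← map_sub] at h
  exact (MulEquiv.isUnit_map (actB σ)).1 h

theorem natCast_unit [CharZero (ResidueField O)] [IsLocalRing (integralClosure O Ω)] (n : ℕ) (hn : 0 < n) :
    (n : ResidueField (integralClosure O Ω)) ≠ 0 := by
  have : (n : ResidueField O) ≠ 0 := by exact_mod_cast hn.ne'
  intro h
  apply this
  apply (algebraMap (ResidueField O) (ResidueField (integralClosure O Ω))).injective
  rw [map_natCast, h, map_zero]

theorem one_unit_root [CharZero (ResidueField O)] [IsLocalRing (integralClosure O Ω)]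
    (E : IntermediateField F Ω) (n : ℕ) (hn : 0 < n)
    (ζ : F) (hζ : IsPrimitiveRoot ζ n) (u : integralClosure O Ω) (hu : (u : Ω) ∈ E)
    (hu1 : residue _ u = 1) : ∃ y : Ω, y ∈ E ∧ y ^ n = u := by
  obtain ⟨y0, hy0⟩ := IsAlgClosed.exists_pow_nat_eq (u : Ω) hn
  have hy0i : IsIntegral O y0 := IsIntegral.of_pow hn (by rw [hy0]; exact u.2)
  obtain ⟨y, rfl⟩ : ∃ y : integralClosure O Ω, (y : Ω) = y0 := ⟨⟨y0, hy0i⟩, rfl⟩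
  have hζΩ : IsPrimitiveRoot (algebraMap F Ω ζ) n := hζ.map_of_injective (algebraMap F Ω).injective
  have hζi : IsIntegral O (algebraMap F Ω ζ) :=
    IsIntegral.of_pow hn (by rw [hζΩ.pow_eq_one]; exact isIntegral_one)
  obtain ⟨z, hz⟩ : ∃ z : integralClosure O Ω, algebraMap _ Ω z = algebraMap F Ω ζ := ⟨⟨_, hζi⟩, rfl⟩
  have hzp : IsPrimitiveRoot z n := by
    rw [← hz] at hζΩ
    exact hζΩ.of_map_of_injective (f := algebraMap (integralClosure O Ω) Ω) Subtype.val_injective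
  have hyu : y ^ n = u := Subtype.ext hy0
  have hprod := hzp.pow_sub_pow_eq_prod_sub_mul 1 y hn
  have h1 : residue _ ((1 : integralClosure O Ω) ^ n - y ^ n) = 0 := by
    rw [hyu, one_pow, map_sub, hu1, map_one, sub_self]
  rw [hprod, map_prod, Finset.prod_eq_zero_iff] at h1
  obtain ⟨ξ, hξ, h2⟩ := h1
  rw [mem_nthRootsFinset hn] at hξ
  set w := ξ * y with hw
  have hwn : w ^ n = u := by rw [hw, mul_pow, hξ, one_mul, hyu]
  have hw1 : residue _ w = 1 := by
    rw [map_sub, map_one, sub_eq_zero] at h2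
    exact h2.symm
  refine ⟨w, ?_, by rw [← hwn]; rfl⟩
  rw [← InfiniteGalois.fixedField_fixingSubgroup E, IntermediateField.mem_fixedField_iff]
  intro σ hσ
  have hσ1 := actB_residue σ w hw1
  have hσu : actB σ u = u := by
    apply Subtype.ext
    rw [actB_coe]
    exact (IntermediateField.mem_fixingSubgroup_iff E σ).1 hσ _ hu
  have hσn : (actB σ w) ^ n = w ^ n := by rw [← map_pow, hwn, hσu]
  have h3 := Commute.geom_sum₂_mul (Commute.all (actB σ w) w) n
  rw [hσn, sub_self] at h3
  rcases mul_eq_zero.1 h3 with h4 | h4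
  · exfalso
    have h5 := congrArg (residue _) h4
    rw [map_sum, map_zero] at h5
    simp only [map_mul, map_pow, hσ1, hw1, one_pow, mul_one, Finset.sum_const, Finset.card_range,
      nsmul_eq_mul] at h5
    exact natCast_unit n hn h5
  · rw [sub_eq_zero] at h4
    rw [← actB_coe, h4]

theorem norm_unit [Algebra.IsAlgebraic O Ω] [IsLocalRing (integralClosure O Ω)] [CharZero F]
    (E : IntermediateField F Ω) [FiniteDimensional F E] (x : E) (a : O) (ha : IsUnit a)
    (hx : Algebra.norm F x = algebraMap O F a) : ∃ u : (integralClosure O Ω)ˣ, ((u : integralClosure O Ω) : Ω) = x := by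
  classical
  have key : ∀ (x : E) (a : O), IsUnit a → Algebra.norm F x = algebraMap O F a →
      (x : Ω) ∈ integralClosure O Ω → ∃ u : (integralClosure O Ω)ˣ, ((u : integralClosure O Ω) : Ω) = x := by
    intro x a ha hx hxi
    have hn := Algebra.norm_eq_prod_embeddings F Ω x
    have hall : ∀ σ : E →ₐ[F] Ω, σ x ∈ integralClosure O Ω := by
      intro σ
      have hst : IsScalarTower O E Ω := IsScalarTower.of_algebraMap_eq (fun r => by
        rw [IsScalarTower.algebraMap_apply O F E, IsScalarTower.algebraMap_apply O F Ω]
        rfl)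
      have : IsIntegral O x := (isIntegral_algebraMap_iff (B := Ω) (Subtype.val_injective)).1 hxi
      exact this.map (σ.restrictScalars O)
    have hd : (⟨x, hxi⟩ : integralClosure O Ω) ∣ algebraMap O _ a := by
      have : algebraMap O (integralClosure O Ω) a = ∏ σ : E →ₐ[F] Ω, ⟨σ x, hall σ⟩ := by
        apply Subtype.ext
        rw [hx, ← IsScalarTower.algebraMap_apply] at hn
        simp only [Subalgebra.coe_algebraMap]
        rw [hn]
        exact (map_prod (algebraMap (integralClosure O Ω) Ω) (fun σ : E →ₐ[F] Ω => ⟨σ x, hall σ⟩) _).symm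
      rw [this]
      exact Finset.dvd_prod_of_mem (fun σ : E →ₐ[F] Ω => (⟨σ x, hall σ⟩ : integralClosure O Ω)) (Finset.mem_univ E.val)
    obtain ⟨u, hu⟩ := isUnit_of_dvd_unit hd (ha.map _)
    exact ⟨u, by rw [hu]⟩
  rcases dich (O := O) (x : Ω) with h | h
  · exact key x a ha hx h
  · obtain ⟨b, rfl⟩ := ha
    obtain ⟨u, hu⟩ := key x⁻¹ ((b⁻¹ : Oˣ) : O) (Units.isUnit _) (by
      have e1 : algebraMap O F ((b⁻¹ : Oˣ) : O) * algebraMap O F (b : O) = 1 := by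
        rw [← map_mul, Units.inv_mul, map_one]
      have hx0 : x ≠ 0 := by
        rintro rfl
        rw [Algebra.norm_zero] at hx
        rw [← hx, mul_zero] at e1
        exact zero_ne_one e1
      have e2 : Algebra.norm F x⁻¹ * Algebra.norm F x = 1 := by
        rw [← map_mul, inv_mul_cancel₀ hx0, map_one]
      rw [eq_inv_of_mul_eq_one_left e1, eq_inv_of_mul_eq_one_left e2, hx]) h
    refine ⟨u⁻¹, ?_⟩
    have : ((u⁻¹ : (integralClosure O Ω)ˣ) : integralClosure O Ω) * (u : integralClosure O Ω) = 1 := Units.inv_mul u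
    have h2 := congrArg (algebraMap (integralClosure O Ω) Ω) this
    rw [map_mul, map_one] at h2
    have h3 := eq_inv_of_mul_eq_one_left h2
    change algebraMap (integralClosure O Ω) Ω _ = _
    rw [h3]
    change ((u : integralClosure O Ω) : Ω)⁻¹ = _
    rw [hu]; simp

/-- residue field of `E`, as a subfield of the residue field of the integral closure. -/
def resField [IsLocalRing (integralClosure O Ω)] (E : IntermediateField F Ω) :
    IntermediateField (ResidueField O) (ResidueField (integralClosure O Ω)) where
  carrier := {r | ∃ b : integralClosure O Ω, (b : Ω) ∈ E ∧ residue _ b = r}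
  mul_mem' := by
    rintro _ _ ⟨a, ha, rfl⟩ ⟨b, hb, rfl⟩
    exact ⟨a * b, E.mul_mem ha hb, map_mul _ _ _⟩
  add_mem' := by
    rintro _ _ ⟨a, ha, rfl⟩ ⟨b, hb, rfl⟩
    exact ⟨a + b, E.add_mem ha hb, map_add _ _ _⟩
  algebraMap_mem' := by
    intro r
    obtain ⟨a, rfl⟩ := residue_surjective r
    refine ⟨algebraMap O _ a, ?_, rfl⟩
    have : ((algebraMap O (integralClosure O Ω) a : integralClosure O Ω) : Ω)
      = algebraMap F Ω (algebraMap O F a) := IsScalarTower.algebraMap_apply O F Ω a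
    rw [this]
    exact E.algebraMap_mem _
  inv_mem' := by
    rintro _ ⟨b, hb, rfl⟩
    by_cases h0 : residue _ b = 0
    · exact ⟨0, E.zero_mem, by rw [h0, inv_zero, map_zero]⟩
    · obtain ⟨u, rfl⟩ := (residue_ne_zero_iff_isUnit b).1 h0
      have h1 := Units.mul_inv u
      refine ⟨((u⁻¹ : (integralClosure O Ω)ˣ) : integralClosure O Ω), ?_, ?_⟩
      · have h2 := congrArg (algebraMap (integralClosure O Ω) Ω) h1
        rw [map_mul, map_one] at h2
        have h3 := eq_inv_of_mul_eq_one_right h2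
        have := E.inv_mem hb
        change algebraMap (integralClosure O Ω) Ω _ ∈ E
        rw [h3]; exact this
      · have h2 := congrArg (residue (integralClosure O Ω)) h1
        rw [map_mul, map_one] at h2
        exact eq_inv_of_mul_eq_one_right h2

theorem mem_resField [IsLocalRing (integralClosure O Ω)] (E : IntermediateField F Ω)
    (r : ResidueField (integralClosure O Ω)) : r ∈ resField (O := O) E ↔
      ∃ b : integralClosure O Ω, (b : Ω) ∈ E ∧ residue _ b = r := Iff.rfl

theorem isAlgClosed_res [IsLocalRing (integralClosure O Ω)] :
    IsAlgClosed (ResidueField (integralClosure O Ω)) := by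
  apply IsAlgClosed.of_exists_root
  intro p hp hirr
  obtain ⟨q, hq, hqd, hqm⟩ := lifts_and_natDegree_eq_and_monic (f := residue (integralClosure O Ω)) (p := p)
    (by
      rw [lifts_iff_coeff_lifts]
      intro n
      exact residue_surjective _) hp
  obtain ⟨x, hx⟩ := IsAlgClosed.exists_root (q.map (algebraMap (integralClosure O Ω) Ω)) (by
    rw [hqm.degree_map, degree_eq_natDegree hqm.ne_zero, hqd]
    have := hirr.natDegree_pos
    exact_mod_cast this.ne')
  rw [IsRoot.def, eval_map] at hx
  have hxi : IsIntegral (integralClosure O Ω) x := ⟨q, hqm, hx⟩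
  have hI : Algebra.IsIntegral O (integralClosure O Ω) := IsIntegralClosure.isIntegral_algebra O Ω
  have hxO : IsIntegral O x := isIntegral_trans x hxi
  refine ⟨residue _ ⟨x, hxO⟩, ?_⟩
  rw [← hq, eval_map, eval₂_at_apply]
  have : q.eval ⟨x, hxO⟩ = 0 := by
    apply Subtype.ext
    change algebraMap (integralClosure O Ω) Ω _ = 0
    rw [← eval₂_at_apply]
    exact hx
  rw [this, map_zero]

theorem isAlgebraic_res [IsLocalRing (integralClosure O Ω)] :
    Algebra.IsAlgebraic (ResidueField O) (ResidueField (integralClosure O Ω)) := by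
  constructor
  intro r
  obtain ⟨b, rfl⟩ := residue_surjective r
  have hI : Algebra.IsIntegral O (integralClosure O Ω) := IsIntegralClosure.isIntegral_algebra O Ω
  have hb := hI.isIntegral b
  have h2 : IsIntegral O (residue _ b) := hb.algebraMap (B := ResidueField (integralClosure O Ω))
  exact (h2.tower_top (A := ResidueField O)).isAlgebraic

theorem rank_resField [IsLocalRing (integralClosure O Ω)] (E : IntermediateField F Ω) [FiniteDimensional F E] :
    Module.rank (ResidueField O) (resField (O := O) E) ≤ Module.finrank F E := by
  classical
  apply rank_le
  intro s hs
  have hl : ∀ i : s, ∃ b : integralClosure O Ω, (b : Ω) ∈ E ∧ residue _ b = ((i : resField (O := O) E) : ResidueField (integralClosure O Ω)) :=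
    fun i => (mem_resField E _).1 (i : resField (O := O) E).2
  choose b hbE hbr using hl
  have hli : LinearIndependent F (fun i : s => (⟨(b i : Ω), hbE i⟩ : E)) := by
    rw [Fintype.linearIndependent_iff]
    intro g hg
    by_contra hne
    push Not at hne
    obtain ⟨i1, hi1⟩ := hne
    obtain ⟨i, -, hij⟩ := exists_min_rel (A := F) (fun x y => ∃ e : O, y = algebraMap O F e * x)
      (fun a => ⟨1, by simp⟩) (fun a c => by
        by_cases ha : a = 0
        · right; exact ⟨0, by simp [ha]⟩
        by_cases hc : c = 0
        · left; exact ⟨0, by simp [hc]⟩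
        rcases ValuationRing.isInteger_or_isInteger O (c / a) with ⟨e, he⟩ | ⟨e, he⟩
        · left; exact ⟨e, by rw [he]; field_simp⟩
        · right; exact ⟨e, by rw [he]; field_simp⟩)
      (fun a c d => by
        rintro ⟨e, rfl⟩ ⟨f, rfl⟩
        exact ⟨f * e, by rw [map_mul]; ring⟩) g Finset.univ ⟨i1, Finset.mem_univ _⟩
    have hij' : ∀ j, ∃ e : O, g j = algebraMap O F e * g i := fun j => hij j (Finset.mem_univ j)
    have hgi : g i ≠ 0 := by
      intro h0
      obtain ⟨e, he⟩ := hij' i1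
      rw [h0, mul_zero] at he
      exact hi1 he
    choose e he using hij'
    have hei : e i = 1 := by
      apply IsFractionRing.injective O F
      rw [map_one]
      exact mul_right_cancel₀ hgi (by rw [← he, one_mul])
    have hsum : ∑ j, algebraMap O (integralClosure O Ω) (e j) * b j = 0 := by
      apply Subtype.ext
      have h1 := congrArg (fun z : E => (z : Ω)) hg
      simp only [AddSubmonoidClass.coe_finsetSum, ZeroMemClass.coe_zero] at h1 ⊢
      have h2 : algebraMap F Ω (g i) * ∑ j, ((algebraMap O (integralClosure O Ω) (e j) * b j : integralClosure O Ω) : Ω) = 0 := by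
        rw [← h1, Finset.mul_sum]
        apply Finset.sum_congr rfl
        intro j _
        have e1 : ((g j • (⟨(b j : Ω), hbE j⟩ : E) : E) : Ω) = algebraMap F Ω (g j) * b j := by
          rw [IntermediateField.coe_smul, Algebra.smul_def]
        rw [e1, he j, map_mul, ← IsScalarTower.algebraMap_apply]
        change _ * (algebraMap O Ω (e j) * (b j : Ω)) = _
        ring
      exact (mul_eq_zero.1 h2).resolve_left (by
        intro h; exact hgi ((algebraMap F Ω).injective (by rw [h, map_zero])))
    have hres := congrArg (residue _) hsum
    rw [map_sum, map_zero] at hres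
    have h3 : ∑ j : s, residue O (e j) • (j : resField (O := O) E) = 0 := by
      apply Subtype.ext
      rw [AddSubmonoidClass.coe_finsetSum, ZeroMemClass.coe_zero, ← hres]
      apply Finset.sum_congr rfl
      intro j _
      rw [map_mul, IntermediateField.coe_smul, Algebra.smul_def, hbr]
      rfl
    have h4 := (Fintype.linearIndependent_iff.1 hs) (fun j => residue O (e j)) h3 i
    rw [hei, map_one] at h4
    exact one_ne_zero h4
  have := hli.fintype_card_le_finrank
  simpa using this

theorem finite_resField [IsLocalRing (integralClosure O Ω)] (E : IntermediateField F Ω) [FiniteDimensional F E] :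
    FiniteDimensional (ResidueField O) (resField (O := O) E) := by
  have := rank_resField (O := O) E
  have hfree : Module.Free (ResidueField O) (resField (O := O) E) := Module.Free.of_divisionRing _ _
  rw [FiniteDimensional, ← Module.rank_lt_aleph0_iff]
  exact this.trans_lt (Cardinal.natCast_lt_aleph0)

variable (F) in
theorem exists_resField [CharZero (ResidueField O)] [IsLocalRing (integralClosure O Ω)]
    (k : IntermediateField (ResidueField O) (ResidueField (integralClosure O Ω)))
    [FiniteDimensional (ResidueField O) k] :
    ∃ E : IntermediateField F Ω, FiniteDimensional F E ∧ resField (O := O) E = k := by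
  obtain ⟨α, hα⟩ := Field.exists_primitive_element (ResidueField O) k
  have hαi : IsIntegral (ResidueField O) α := Algebra.IsIntegral.isIntegral α
  obtain ⟨q, hq, hqd, hqm⟩ := lifts_and_natDegree_eq_and_monic (f := residue O) (p := minpoly (ResidueField O) α)
    (by
      rw [lifts_iff_coeff_lifts]
      intro n
      exact residue_surjective _) (minpoly.monic hαi)
  obtain ⟨s, hs⟩ := exists_factor (Ω := Ω) q hqm
  have h0 : aeval (α : ResidueField (integralClosure O Ω)) (minpoly (ResidueField O) α) = 0 := by
    have := congrArg (algebraMap k (ResidueField (integralClosure O Ω))) (minpoly.aeval (ResidueField O) α)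
    rwa [map_zero, ← aeval_algebraMap_apply] at this
  obtain ⟨z, hz, hzα⟩ : ∃ z ∈ s, residue _ z = (α : ResidueField (integralClosure O Ω)) := by
    have h1 : (q.map (algebraMap O (integralClosure O Ω))).map (residue (integralClosure O Ω)) =
        (minpoly (ResidueField O) α).map (algebraMap (ResidueField O) (ResidueField (integralClosure O Ω))) := by
      rw [← hq, Polynomial.map_map, Polynomial.map_map]
      rfl
    rw [hs, Polynomial.map_multiset_prod, Multiset.map_map] at h1
    rw [← eval_map_algebraMap, ← h1, eval_multiset_prod, Multiset.map_map, Multiset.prod_eq_zero_iff,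
      Multiset.mem_map] at h0
    obtain ⟨z, hz, hz'⟩ := h0
    refine ⟨z, hz, ?_⟩
    simp [sub_eq_zero] at hz'
    exact hz'.symm
  have hqz : aeval (z : Ω) (q.map (algebraMap O F)) = 0 := by
    rw [aeval_map_algebraMap]
    have h1 : aeval z q = 0 := by
      rw [← eval_map_algebraMap, hs, eval_multiset_prod, Multiset.map_map, Multiset.prod_eq_zero_iff,
        Multiset.mem_map]
      exact ⟨z, hz, by simp⟩
    have := congrArg (algebraMap (integralClosure O Ω) Ω) h1
    rwa [map_zero, ← aeval_algebraMap_apply] at this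
  have hzi : IsIntegral F (z : Ω) := ⟨_, hqm.map _, hqz⟩
  have hfd : FiniteDimensional F (IntermediateField.adjoin F {(z : Ω)}) :=
    IntermediateField.adjoin.finiteDimensional hzi
  refine ⟨IntermediateField.adjoin F {(z : Ω)}, hfd, ?_⟩
  have hfd2 := finite_resField (O := O) (IntermediateField.adjoin F {(z : Ω)})
  symm
  apply IntermediateField.eq_of_le_of_finrank_le
  · have h1 : IntermediateField.adjoin (ResidueField O) {(α : ResidueField (integralClosure O Ω))} = k := by
      have := congrArg IntermediateField.lift hα
      rwa [IntermediateField.lift_adjoin_simple, IntermediateField.lift_top] at this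
    rw [← h1, IntermediateField.adjoin_simple_le_iff, mem_resField]
    exact ⟨z, IntermediateField.mem_adjoin_simple_self F _, hzα⟩
  · have h1 := Module.finrank_le_of_rank_le (rank_resField (O := O) (IntermediateField.adjoin F {(z : Ω)}))
    refine h1.trans ?_
    rw [IntermediateField.adjoin.finrank hzi]
    have h2 : (minpoly F (z : Ω)).natDegree ≤ (q.map (algebraMap O F)).natDegree :=
      natDegree_le_of_dvd (minpoly.dvd F _ hqz) (hqm.map _).ne_zero
    refine h2.trans ?_
    rw [hqm.natDegree_map, hqd]
    have h3 := IntermediateField.adjoin.finrank hαi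
    rw [hα, IntermediateField.finrank_top'] at h3
    exact h3.ge

/-- the valuation ring of `E`. -/
def ringE (O : Type*) [CommRing O] [Algebra O Ω] (E : IntermediateField F Ω) : Subring E :=
  (integralClosure O Ω).toSubring.comap (algebraMap E Ω)

/-- the inclusion of the valuation ring of `E` in the integral closure. -/
def ringEtoB (O : Type*) [CommRing O] [Algebra O Ω] (E : IntermediateField F Ω) :
    ringE O E →+* integralClosure O Ω where
  toFun x := ⟨(x : E), x.2⟩
  map_one' := rfl
  map_mul' _ _ := rfl
  map_zero' := rfl
  map_add' _ _ := rfl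

/-- residue map of `E`. -/
noncomputable def resE [IsLocalRing (integralClosure O Ω)] (E : IntermediateField F Ω) :
    ringE O E →+* resField (O := O) E :=
  ((residue (integralClosure O Ω)).comp (ringEtoB O E)).codRestrict (resField (O := O) E)
    (fun x => ⟨ringEtoB O E x, (x : E).2, rfl⟩)

/-- inclusion of units. -/
def unitsE (O : Type*) [CommRing O] [Algebra O Ω] (E : IntermediateField F Ω) :
    (ringE O E)ˣ →* Eˣ := Units.map ((ringE O E).subtype : ringE O E →* E)

theorem mem_range_unitsE (E : IntermediateField F Ω) (x : Eˣ) (h1 : ((x : E) : Ω) ∈ integralClosure O Ω)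
    (h2 : (((x⁻¹ : Eˣ) : E) : Ω) ∈ integralClosure O Ω) : ∃ g : (ringE O E)ˣ, unitsE O E g = x :=
  ⟨⟨⟨x, h1⟩, ⟨((x⁻¹ : Eˣ) : E), h2⟩, Subtype.ext (Units.mul_inv x), Subtype.ext (Units.inv_mul x)⟩,
    Units.ext rfl⟩

theorem mem_range_unitsE' (E : IntermediateField F Ω) (x : E) (u : (integralClosure O Ω)ˣ)
    (h : ((u : integralClosure O Ω) : Ω) = x) : ∃ g : (ringE O E)ˣ, ((g : ringE O E) : E) = x := by
  have h1 : ((u : integralClosure O Ω) : Ω) * (((u⁻¹ : (integralClosure O Ω)ˣ) : integralClosure O Ω) : Ω) = 1 := by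
    rw [← MulMemClass.coe_mul, Units.mul_inv]; rfl
  have hx0 : x ≠ 0 := by
    rintro rfl
    rw [h] at h1
    simp at h1
  obtain ⟨g, hg⟩ := mem_range_unitsE (O := O) E (Units.mk0 x hx0) (by
    rw [Units.val_mk0, ← h]; exact Subtype.property _) (by
    have := eq_inv_of_mul_eq_one_right h1
    rw [h] at this
    have e : (((Units.mk0 x hx0)⁻¹ : Eˣ) : E) = x⁻¹ := rfl
    rw [e]
    change ((x : Ω))⁻¹ ∈ _
    rw [← this]
    exact Subtype.property _)
  exact ⟨g, congrArg Units.val hg⟩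

theorem resE_surj [IsLocalRing (integralClosure O Ω)] (E : IntermediateField F Ω) :
    Function.Surjective (Units.map (resE (O := O) E : ringE O E →* resField (O := O) E)) := by
  intro r
  obtain ⟨b, hbE, hbr⟩ := (mem_resField E _).1 (r : resField (O := O) E).2
  have hne : residue _ b ≠ 0 := by
    rw [hbr]
    intro h
    exact r.ne_zero (Subtype.ext h)
  obtain ⟨u, hu⟩ := (residue_ne_zero_iff_isUnit b).1 hne
  obtain ⟨g, hg⟩ := mem_range_unitsE' E ⟨b, hbE⟩ u (by rw [hu])
  refine ⟨g, Units.ext (Subtype.ext ?_)⟩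
  rw [← hbr]
  change residue _ (ringEtoB O E g) = _
  congr 1
  apply Subtype.ext
  exact congrArg (fun z : E => (z : Ω)) hg

theorem fin_iff {G : Type*} [CommGroup G] (n : ℕ) :
    Finite (G ⧸ (powMonoidHom n : G →* G).range) ↔ (powMonoidHom n : G →* G).range.FiniteIndex :=
  Subgroup.finiteIndex_iff_finite_quotient.symm

theorem fin_comap {G H : Type*} [Group G] [CommGroup H] (f : G →* H) (N : Subgroup H) (h : N.FiniteIndex) :
    (N.comap f).FiniteIndex := by
  constructor
  rw [Subgroup.index_comap]
  intro h0
  have h1 := Subgroup.relIndex_dvd_index_of_normal N f.range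
  rw [h0, zero_dvd_iff] at h1
  exact h.index_ne_zero h1

theorem fin_of_surj {G H : Type*} [CommGroup G] [CommGroup H] (f : G →* H) (hf : Function.Surjective f) (n : ℕ)
    (h : (powMonoidHom n : G →* G).range.FiniteIndex) : (powMonoidHom n : H →* H).range.FiniteIndex := by
  have h1 : ((powMonoidHom n : G →* G).range.map f) ≤ (powMonoidHom n : H →* H).range := by
    rintro _ ⟨_, ⟨g, rfl⟩, rfl⟩
    exact ⟨f g, by simp⟩
  constructor
  intro h0
  have h2 := Subgroup.index_dvd_of_le h1
  rw [h0, zero_dvd_iff] at h2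
  have h3 := Subgroup.index_map_dvd (powMonoidHom n : G →* G).range hf
  rw [h2, zero_dvd_iff] at h3
  exact h.index_ne_zero h3

theorem fin_pow {G : Type*} [CommGroup G]
    (h : ∀ p : ℕ, p.Prime → (powMonoidHom p : G →* G).range.FiniteIndex) (m : ℕ) (hm : m ≠ 0) :
    (powMonoidHom m : G →* G).range.FiniteIndex := by
  induction m using induction_on_primes with
  | zero => exact absurd rfl hm
  | one =>
    have : (powMonoidHom 1 : G →* G).range = ⊤ := by
      rw [MonoidHom.range_eq_top]
      intro x
      exact ⟨x, by simp⟩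
    rw [this]; infer_instance
  | prime_mul p a hp ih =>
    have ha : a ≠ 0 := by rintro rfl; simp at hm
    have e : (powMonoidHom (p * a) : G →* G).range = (powMonoidHom a : G →* G).range.map (powMonoidHom p) := by
      ext x
      constructor
      · rintro ⟨y, rfl⟩
        exact ⟨y ^ a, ⟨y, rfl⟩, by simp [← pow_mul, mul_comm]⟩
      · rintro ⟨_, ⟨y, rfl⟩, rfl⟩
        exact ⟨y, by simp [← pow_mul, mul_comm]⟩
    constructor
    rw [e, Subgroup.index_map]
    have := ih ha
    have h2 := Subgroup.finiteIndex_of_le (le_sup_left : (powMonoidHom a : G →* G).range ≤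
      (powMonoidHom a : G →* G).range ⊔ (powMonoidHom p : G →* G).ker)
    exact mul_ne_zero h2.index_ne_zero (h p hp).index_ne_zero

theorem forward [IsLocalRing (integralClosure O Ω)] (E : IntermediateField F Ω) (n : ℕ) (hn : 0 < n)
    (h : (powMonoidHom n : Eˣ →* Eˣ).range.FiniteIndex) :
    (powMonoidHom n : (resField (O := O) E)ˣ →* (resField (O := O) E)ˣ).range.FiniteIndex := by
  refine fin_of_surj _ (resE_surj (O := O) E) n ?_
  have e : (powMonoidHom n : Eˣ →* Eˣ).range.comap (unitsE O E) ≤ (powMonoidHom n : (ringE O E)ˣ →* (ringE O E)ˣ).range := by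
    rintro g ⟨y, hy⟩
    have hy1 : y ^ n = unitsE O E g := hy
    have hy2 : (((y : E) : Ω)) ^ n = ((g : ringE O E) : E) := congrArg (fun z : Eˣ => ((z : E) : Ω)) hy1
    have hy3 : ((((y⁻¹ : Eˣ) : E) : Ω)) ^ n = (((g⁻¹ : (ringE O E)ˣ) : ringE O E) : E) := by
      have : (y⁻¹) ^ n = unitsE O E g⁻¹ := by rw [inv_pow, hy1, map_inv]
      exact congrArg (fun z : Eˣ => ((z : E) : Ω)) this
    obtain ⟨w, hw⟩ := mem_range_unitsE (O := O) E y
      (IsIntegral.of_pow hn (by rw [hy2]; exact (g : ringE O E).2))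
      (IsIntegral.of_pow hn (by rw [hy3]; exact ((g⁻¹ : (ringE O E)ˣ) : ringE O E).2))
    refine ⟨w, ?_⟩
    apply Units.ext
    apply Subtype.ext
    rw [← hw, ← map_pow] at hy1
    exact congrArg Units.val hy1
  have := fin_comap (unitsE O E) _ h
  exact Subgroup.finiteIndex_of_le e

theorem backward [CharZero (ResidueField O)] [IsLocalRing (integralClosure O Ω)] (E : IntermediateField F Ω)
    (n : ℕ) (hn : 0 < n) (ζ : F) (hζ : IsPrimitiveRoot ζ n)
    (h : (powMonoidHom n : (resField (O := O) E)ˣ →* (resField (O := O) E)ˣ).range.FiniteIndex)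
    (P : Subgroup Eˣ) (hP : P.FiniteIndex)
    (hPU : ∀ x ∈ P, ∃ g : (ringE O E)ˣ, ∃ y : Eˣ, x = unitsE O E g * y ^ n) :
    (powMonoidHom n : Eˣ →* Eˣ).range.FiniteIndex := by
  set N := (powMonoidHom n : Eˣ →* Eˣ).range
  set ρ := Units.map (resE (O := O) E : ringE O E →* resField (O := O) E)
  have e : (powMonoidHom n : (resField (O := O) E)ˣ →* (resField (O := O) E)ˣ).range.comap ρ ≤
      N.comap (unitsE O E) := by
    rintro g ⟨r, hr⟩
    obtain ⟨w, rfl⟩ := resE_surj (O := O) E r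
    have hr1 : ρ w ^ n = ρ g := hr
    have h1 : ρ (g * (w ^ n)⁻¹) = 1 := by rw [map_mul, map_inv, map_pow, hr1, mul_inv_cancel]
    obtain ⟨y, hyE, hy⟩ := one_unit_root E n hn ζ hζ (ringEtoB O E ((g * (w ^ n)⁻¹ : (ringE O E)ˣ) : ringE O E))
      (Subtype.property (Subtype.val ((g * (w ^ n)⁻¹ : (ringE O E)ˣ) : ringE O E)))
      (congrArg (fun z : (resField (O := O) E)ˣ => ((z : resField (O := O) E) : ResidueField (integralClosure O Ω))) h1)
    have hy0 : (⟨y, hyE⟩ : E) ^ n = (unitsE O E (g * (w ^ n)⁻¹) : E) := Subtype.ext hy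
    have hyne : (⟨y, hyE⟩ : E) ≠ 0 := by
      intro h0
      rw [h0, zero_pow hn.ne'] at hy0
      exact (unitsE O E (g * (w ^ n)⁻¹)).ne_zero hy0.symm
    refine ⟨Units.mk0 _ hyne * unitsE O E w, ?_⟩
    have h2 : (Units.mk0 _ hyne) ^ n = unitsE O E (g * (w ^ n)⁻¹) := Units.ext hy0
    change (Units.mk0 _ hyne * unitsE O E w) ^ n = _
    rw [mul_pow, h2, map_mul, map_inv, map_pow, inv_mul_cancel_right]
  have hc := fin_comap ρ _ h
  have h1 : (N.comap (unitsE O E)).FiniteIndex := Subgroup.finiteIndex_of_le e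
  have h2 := h1.index_ne_zero
  rw [Subgroup.index_comap, ← Subgroup.relIndex_sup_right] at h2
  have h3 : P ≤ (unitsE O E).range ⊔ N := by
    intro x hx
    obtain ⟨g, y, rfl⟩ := hPU x hx
    exact Subgroup.mul_mem_sup ⟨g, rfl⟩ ⟨y, rfl⟩
  have h4 := Subgroup.finiteIndex_of_le h3
  constructor
  rw [← Subgroup.relIndex_mul_index (le_sup_right : N ≤ (unitsE O E).range ⊔ N)]
  exact mul_ne_zero h2 h4.index_ne_zero

end General

theorem condF2_of {κ K : Type*} [Field κ] [Field K] [Algebra κ K] [IsAlgClosed K] [Algebra.IsAlgebraic κ K] :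
    CondF2 κ ↔ ∀ n : ℕ, 0 < n → ∀ E : IntermediateField κ K, FiniteDimensional κ E →
      (powMonoidHom n : Eˣ →* Eˣ).range.FiniteIndex := by
  have : IsAlgClosure κ K := ⟨inferInstance, inferInstance⟩
  let e : AlgebraicClosure κ ≃ₐ[κ] K := IsAlgClosure.equiv κ _ _
  constructor
  · intro h n hn E hE
    let e' := E.equivMap (e.symm : K →ₐ[κ] AlgebraicClosure κ)
    have hfd : FiniteDimensional κ (E.map (e.symm : K →ₐ[κ] AlgebraicClosure κ)) :=
      Module.Finite.equiv e'.toLinearEquiv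
    have h1 := (fin_iff n).1 (h n hn _ hfd)
    exact fin_of_surj (Units.mapEquiv e'.symm.toMulEquiv).toMonoidHom (Units.mapEquiv e'.symm.toMulEquiv).surjective n h1
  · intro h n hn E hE
    let e' := E.equivMap (e : AlgebraicClosure κ →ₐ[κ] K)
    have hfd : FiniteDimensional κ (E.map (e : AlgebraicClosure κ →ₐ[κ] K)) :=
      Module.Finite.equiv e'.toLinearEquiv
    have h1 := h n hn _ hfd
    rw [fin_iff]
    exact fin_of_surj (Units.mapEquiv e'.symm.toMulEquiv).toMonoidHom (Units.mapEquiv e'.symm.toMulEquiv).surjective n h1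

theorem stmt16 (F : Type*) [Field F] (Γ₀ : Type*) [LinearOrderedCommGroupWithZero Γ₀]
    (v : Valuation F Γ₀) (hv : Function.Surjective v)
    [HenselianLocalRing v.valuationSubring]
    [CharZero (IsLocalRing.ResidueField v.valuationSubring)]
    (hμ : ∀ n : ℕ, 0 < n → ∃ ζ : F, IsPrimitiveRoot ζ n)
    (hΓ : ∀ p : ℕ, p.Prime →
      Finite (Γ₀ˣ ⧸ (powMonoidHom p : Γ₀ˣ →* Γ₀ˣ).range)) :
    CondF2 F ↔ CondF2 (IsLocalRing.ResidueField v.valuationSubring) := by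
  have hO : CharZero v.valuationSubring := RingHom.charZero (IsLocalRing.residue v.valuationSubring)
  have hF : CharZero F := charZero_of_injective_algebraMap (R := v.valuationSubring) Subtype.val_injective
  have hfs : FaithfulSMul v.valuationSubring (AlgebraicClosure F) := by
    rw [faithfulSMul_iff_algebraMap_injective, IsScalarTower.algebraMap_eq _ F]
    exact (algebraMap F (AlgebraicClosure F)).injective.comp Subtype.val_injective
  have halg : Algebra.IsAlgebraic v.valuationSubring (AlgebraicClosure F) :=
    (IsFractionRing.comap_isAlgebraic_iff (K := F)).2 inferInstance
  have hloc : IsLocalRing (integralClosure v.valuationSubring (AlgebraicClosure F)) :=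
    isLocalRing_B F
  have hac := isAlgClosed_res (O := v.valuationSubring) (Ω := AlgebraicClosure F)
  have hal := isAlgebraic_res (O := v.valuationSubring) (Ω := AlgebraicClosure F)
  rw [condF2_of (κ := IsLocalRing.ResidueField v.valuationSubring)
    (K := IsLocalRing.ResidueField (integralClosure v.valuationSubring (AlgebraicClosure F)))]
  constructor
  · intro h n hn k hk
    obtain ⟨E, hE, rfl⟩ := exists_resField F k
    exact forward E n hn ((fin_iff n).1 (h n hn E hE))
  · intro h n hn E hE
    obtain ⟨ζ, hζ⟩ := hμ n hn
    rw [fin_iff]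
    let Φ : Eˣ →* Γ₀ˣ := (Units.map (v.toMonoidWithZeroHom : F →* Γ₀)).comp
      (Units.map (Algebra.norm F : E →* F))
    have hΦ : ∀ x : Eˣ, ((Φ x : Γ₀ˣ) : Γ₀) = v (Algebra.norm F (x : E)) := fun x => rfl
    set d := Module.finrank F E
    have hd : 0 < d := Module.finrank_pos
    have hfin : (powMonoidHom (d * n) : Γ₀ˣ →* Γ₀ˣ).range.FiniteIndex :=
      fin_pow (fun p hp => (fin_iff p).1 (hΓ p hp)) _ (Nat.mul_pos hd hn).ne'
    refine backward (O := v.valuationSubring) E n hn ζ hζ (h n hn _ (finite_resField E))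
      ((powMonoidHom (d * n) : Γ₀ˣ →* Γ₀ˣ).range.comap Φ) (fin_comap _ _ hfin) ?_
    rintro x ⟨γ, hγ⟩
    obtain ⟨c, hc⟩ := hv (γ : Γ₀)
    have hc0 : c ≠ 0 := by
      rintro rfl
      rw [map_zero] at hc
      exact γ.ne_zero hc.symm
    let y : Eˣ := Units.map (algebraMap F E : F →* E) (Units.mk0 c hc0)
    have hΦy : Φ y = γ ^ d := by
      apply Units.ext
      rw [hΦ]
      change v (Algebra.norm F (algebraMap F E c)) = _
      rw [Algebra.norm_algebraMap, map_pow, hc, Units.val_pow_eq_pow_val]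
    have hΦ1 : Φ (x * (y ^ n)⁻¹) = 1 := by
      have hγ' : γ ^ (d * n) = Φ x := hγ
      rw [map_mul, map_inv, map_pow, hΦy, ← pow_mul, hγ', mul_inv_cancel]
    have hΦ2 : v (Algebra.norm F ((x * (y ^ n)⁻¹ : Eˣ) : E)) = 1 := by
      rw [← hΦ, hΦ1]; rfl
    set t : F := Algebra.norm F ((x * (y ^ n)⁻¹ : Eˣ) : E) with ht
    have ht0 : t ≠ 0 := by
      intro h0
      rw [h0, map_zero] at hΦ2
      exact zero_ne_one hΦ2
    have ht1 : t ∈ v.valuationSubring := (v.mem_valuationSubring_iff t).2 hΦ2.le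
    have ht2 : t⁻¹ ∈ v.valuationSubring := (v.mem_valuationSubring_iff _).2 (by
      rw [map_inv₀, hΦ2, inv_one])
    have hu : IsUnit (⟨t, ht1⟩ : v.valuationSubring) :=
      IsUnit.of_mul_eq_one ⟨t⁻¹, ht2⟩ (Subtype.ext (mul_inv_cancel₀ ht0))
    obtain ⟨u, hu⟩ := norm_unit E ((x * (y ^ n)⁻¹ : Eˣ) : E) (⟨t, ht1⟩ : v.valuationSubring) hu rfl
    obtain ⟨g, hg⟩ := mem_range_unitsE' E _ u hu
    refine ⟨g, y, ?_⟩
    have : unitsE v.valuationSubring E g = x * (y ^ n)⁻¹ := Units.ext hg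
    rw [this, inv_mul_cancel_right]
end
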